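/- arXiv:1307.3208 — 2 statements merged into one kernel-verified Lean document; each statement's English description precedes it below -/
import Mathlib

section
/- Let k ≥ 1 be an integer and let P ⊂ ℝ^n (n ≥ 2) be a full-dimensional smooth lattice polytope that is canonically positioned, such that every edge of P has lattice length at least k, and such that for each j ∈ {1, …, n} the set F_j := P ∩ {x : x_j = 0} is a facet of P which is a Cayley polytope of order k with altitude in direction e_{i(j)} for some i(j) ∈ {1, …, n} with i(j) ≠ j. If the edge of P contained in the nonnegative x_1-coordinate axis has lattice length strictly greater than k, then there exists i ∈ {1, …, n} such that P ⊆ {x : 0 ≤ x_i ≤ k}; in particular, P is a Cayley polytope of order k with altitude in direction e_i. -/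
open Set

/-- The real point corresponding to an integer lattice point. -/
def toR {n : ℕ} (v : Fin n → ℤ) : Fin n → ℝ := fun i => (v i : ℝ)

/-- `P` is a lattice polytope: the convex hull of a finite set of integer points. -/
def IsLatticePolytope {n : ℕ} (P : Set (Fin n → ℝ)) : Prop :=
  ∃ S : Finset (Fin n → ℤ), P = convexHull ℝ (toR '' (S : Set (Fin n → ℤ)))

/-- `P` is full-dimensional: its affine span is everything. -/
def IsFullDim {n : ℕ} (P : Set (Fin n → ℝ)) : Prop :=
  affineSpan ℝ P = ⊤

/-- A vertex of `P` is an extreme point of `P`. -/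
def IsVertex {n : ℕ} (P : Set (Fin n → ℝ)) (v : Fin n → ℝ) : Prop :=
  v ∈ Set.extremePoints ℝ P

/-- The segment from `a` to `b` (distinct integer points) is an edge of `P`,
i.e. an exposed face of `P` which is a segment. -/
def IsEdge {n : ℕ} (P : Set (Fin n → ℝ)) (a b : Fin n → ℤ) : Prop :=
  a ≠ b ∧ IsExposed ℝ P (segment ℝ (toR a) (toR b))

/-- The lattice length of an integer vector: the gcd of its entries. -/
def latticeLength {n : ℕ} (v : Fin n → ℤ) : ℕ :=
  Finset.univ.gcd fun i => (v i).natAbs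

/-- The primitive integer vector in the direction of `v`. -/
def primVec {n : ℕ} (v : Fin n → ℤ) : Fin n → ℤ :=
  fun i => v i / (latticeLength v : ℤ)

/-- `P` is smooth at the integer vertex `v`: there are exactly `n` edges through `v`
and the primitive directions of these edges form a `ℤ`-basis of `ℤⁿ`. -/
def SmoothAtVertex {n : ℕ} (P : Set (Fin n → ℝ)) (v : Fin n → ℤ) : Prop :=
  ∃ b : Fin n → (Fin n → ℤ),
    Function.Injective b ∧
    (∀ i, IsEdge P v (b i)) ∧
    (∀ c : Fin n → ℤ, IsEdge P v c →
      ∃ i, segment ℝ (toR v) (toR c) = segment ℝ (toR v) (toR (b i))) ∧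
    IsUnit (Matrix.det (Matrix.of fun i => primVec (b i - v)))

/-- `P` is a full-dimensional smooth lattice polytope. -/
def IsSmoothPolytope {n : ℕ} (P : Set (Fin n → ℝ)) : Prop :=
  IsLatticePolytope P ∧ IsFullDim P ∧
    ∀ v : Fin n → ℤ, IsVertex P (toR v) → SmoothAtVertex P v

/-- Every edge of `P` has lattice length at least `k`. -/
def EdgesAtLeast {n : ℕ} (P : Set (Fin n → ℝ)) (k : ℕ) : Prop :=
  ∀ a b : Fin n → ℤ, IsEdge P a b → k ≤ latticeLength (b - a)

/-- `P` is a Cayley polytope of order `k` with altitude in direction `eᵢ`: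
`P ⊆ {x : 0 ≤ xᵢ ≤ k}` and every vertex of `P` has `i`-th coordinate `0` or `k`. -/
def IsCayley {n : ℕ} (P : Set (Fin n → ℝ)) (k : ℕ) (i : Fin n) : Prop :=
  (∀ x ∈ P, 0 ≤ x i ∧ x i ≤ (k : ℝ)) ∧
  (∀ v : Fin n → ℝ, IsVertex P v → v i = 0 ∨ v i = (k : ℝ))

/-- `P` is canonically positioned: `0` is a vertex and for each `i` there is an
edge of `P` contained in the nonnegative `xᵢ`-coordinate axis. -/
def CanonicallyPositioned {n : ℕ} (P : Set (Fin n → ℝ)) : Prop :=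
  IsVertex P 0 ∧
  ∀ i : Fin n, ∃ a b : Fin n → ℤ, IsEdge P a b ∧
    segment ℝ (toR a) (toR b) ⊆ {x | 0 ≤ x i ∧ ∀ j, j ≠ i → x j = 0}

/-- `F` is a facet of `P`: an exposed face of dimension `n - 1`. -/
def IsFacet {n : ℕ} (P F : Set (Fin n → ℝ)) : Prop :=
  IsExposed ℝ P F ∧ Module.finrank ℝ (affineSpan ℝ F).direction = n - 1

/-- The lattice width of `Q`: the minimum over nonzero integer functionals `φ` of
`max_{x ∈ Q} ⟨φ, x⟩ - min_{x ∈ Q} ⟨φ, x⟩`. -/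
noncomputable def latticeWidth {n : ℕ} (Q : Set (Fin n → ℝ)) : ℝ :=
  ⨅ φ : {φ : Fin n → ℤ // φ ≠ 0},
    (sSup ((fun x => ∑ i, (φ.1 i : ℝ) * x i) '' Q) -
      sInf ((fun x => ∑ i, (φ.1 i : ℝ) * x i) '' Q))

theorem exists_forall_lt_of_mem_extremePoints_convexHull {E : Type*} [NormedAddCommGroup E]
    [NormedSpace ℝ E] {T : Set E} (hT : T.Finite) {x : E}
    (hx : x ∈ (convexHull ℝ T).extremePoints ℝ) :
    ∃ l : E →L[ℝ] ℝ, ∀ t ∈ T, t ≠ x → l x < l t := by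
  have hmem : x ∉ convexHull ℝ (T \ {x}) := fun h =>
    (((convex_convexHull ℝ T).mem_extremePoints_iff_mem_sdiff_convexHull_sdiff).1 hx).2
      (convexHull_mono (sdiff_subset_sdiff_left (subset_convexHull ℝ T)) h)
  obtain ⟨l, u, hlx, hl⟩ := geometric_hahn_banach_point_closed (convex_convexHull ℝ _)
    ((hT.sdiff (t := {x})).isClosed_convexHull ℝ) hmem
  exact ⟨l, fun t ht htx => hlx.trans (hl t (subset_convexHull ℝ _ ⟨ht, htx⟩))⟩

theorem isExposed_convexHull_segment {E : Type*} [NormedAddCommGroup E] [NormedSpace ℝ E]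
    {T : Set E} {v w : E} (hv : v ∈ T) (hw : w ∈ T) (m : E →L[ℝ] ℝ) (hvw : m w = m v)
    (hm : ∀ t ∈ T, m v ≤ m t) (hseg : ∀ t ∈ T, m t = m v → t ∈ segment ℝ v w) :
    IsExposed ℝ (convexHull ℝ T) (segment ℝ v w) := by
  have hconv : Convex ℝ {x | m v ≤ m x ∧ (m x = m v → x ∈ segment ℝ v w)} := by
    rw [convex_iff_forall_pos]
    rintro x ⟨hx, hx'⟩ y ⟨hy, hy'⟩ a b ha hb hab
    have hval : m (a • x + b • y) - m v = a * (m x - m v) + b * (m y - m v) := by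
      simp only [map_add, map_smul, smul_eq_mul]
      linear_combination (m v) * hab
    refine ⟨by nlinarith [mul_nonneg ha.le (sub_nonneg.2 hx), mul_nonneg hb.le (sub_nonneg.2 hy)],
      fun h => ?_⟩
    have h1 := mul_nonneg ha.le (sub_nonneg.2 hx)
    have h2 := mul_nonneg hb.le (sub_nonneg.2 hy)
    have h3 : a * (m x - m v) = 0 := by linarith
    have h4 : b * (m y - m v) = 0 := by linarith
    have h5 := (mul_eq_zero.1 h3).resolve_left ha.ne'
    have h6 := (mul_eq_zero.1 h4).resolve_left hb.ne'
    exact convex_segment v w (hx' (by linarith)) (hy' (by linarith)) ha.le hb.le hab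
  have hsub : convexHull ℝ T ⊆ {x | m v ≤ m x ∧ (m x = m v → x ∈ segment ℝ v w)} :=
    convexHull_min (fun t ht => ⟨hm t ht, hseg t ht⟩) hconv
  intro _
  refine ⟨-m, Subset.antisymm (fun x hx => ?_) fun x hx => ?_⟩
  · refine ⟨(convex_convexHull ℝ T).segment_subset (subset_convexHull ℝ T hv)
      (subset_convexHull ℝ T hw) hx, fun y hy => ?_⟩
    obtain ⟨a, b, -, -, hab, rfl⟩ := hx
    have hval : m (a • v + b • w) = m v := by
      simp only [map_add, map_smul, smul_eq_mul, hvw]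
      linear_combination (m v) * hab
    simpa [hval] using (hsub hy).1
  · refine (hsub hx.1).2 (le_antisymm ?_ (hsub hx.1).1)
    simpa using hx.2 v (subset_convexHull ℝ T hv)

theorem exists_isExposed_segment_lt {E : Type*} [NormedAddCommGroup E] [NormedSpace ℝ E]
    {T : Set E} (hT : T.Finite) {v : E} (hv : v ∈ (convexHull ℝ T).extremePoints ℝ)
    (f : E →L[ℝ] ℝ) {p : E} (hp : p ∈ convexHull ℝ T) (hfp : f p < f v) :
    ∃ w ∈ T, IsExposed ℝ (convexHull ℝ T) (segment ℝ v w) ∧ f w < f v := by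
  have hvT : v ∈ T := extremePoints_convexHull_subset hv
  obtain ⟨h, hh⟩ := exists_forall_lt_of_mem_extremePoints_convexHull hT hv
  obtain ⟨s, hsT, hs⟩ : ∃ s ∈ T, f s < f v := by
    by_contra! hcon
    have : convexHull ℝ T ⊆ {x | f v ≤ f x} :=
      convexHull_min hcon (convex_halfSpace_ge f.toLinearMap.isLinear _)
    exact absurd (this hp) (not_le.2 hfp)
  set q : E → E := fun t => (h (t - v))⁻¹ • (t - v) with hq
  have hpos : ∀ t ∈ T, t ≠ v → 0 < h (t - v) := fun t ht htv => by
    rw [map_sub]; exact sub_pos.2 (hh t ht htv)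
  have hqh : ∀ t ∈ T, t ≠ v → t - v = h (t - v) • q t := fun t ht htv => by
    rw [hq, smul_inv_smul₀ (hpos t ht htv).ne']
  have hQ : (q '' (T \ {v})).Finite := hT.sdiff.image q
  obtain ⟨e, he, hfe⟩ : ∃ e ∈ (convexHull ℝ (q '' (T \ {v}))).extremePoints ℝ, f e < 0 := by
    by_contra! hcon
    have hcl : IsClosed {x | 0 ≤ f x} := isClosed_le continuous_const f.continuous
    have hsub : convexHull ℝ (q '' (T \ {v})) ⊆ {x | 0 ≤ f x} := by
      rw [← closure_convexHull_extremePoints (hQ.isCompact_convexHull ℝ) (convex_convexHull ℝ _)]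
      exact closure_minimal
        (convexHull_min hcon (convex_halfSpace_ge f.toLinearMap.isLinear _)) hcl
    have hsv : s ≠ v := by rintro rfl; exact hs.false
    have h1 : 0 ≤ f (q s) := hsub (subset_convexHull ℝ _ ⟨s, ⟨hsT, hsv⟩, rfl⟩)
    have h2 : f (s - v) = h (s - v) * f (q s) := by
      conv_lhs => rw [hqh s hsT hsv]
      simp
    have h3 := mul_nonneg (hpos s hsT hsv).le h1
    rw [← h2, map_sub] at h3
    linarith
  obtain ⟨l, hl⟩ := exists_forall_lt_of_mem_extremePoints_convexHull hQ he
  obtain ⟨w₀, hw₀, hw₀e⟩ := extremePoints_convexHull_subset he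
  obtain ⟨w, ⟨⟨hwT, hwv⟩, hwe⟩, hwmax⟩ := ((hT.sdiff (t := {v})).subset
    (sep_subset _ fun t => q t = e)).exists_maximalFor h _ ⟨w₀, hw₀, hw₀e⟩
  have hwv : w ≠ v := hwv
  have hm : ∀ t ∈ T, t ≠ v → (l - l e • h) t - (l - l e • h) v = h (t - v) * (l (q t) - l e) := by
    intro t ht htv
    rw [← map_sub]
    have : l (t - v) = h (t - v) * l (q t) := by
      conv_lhs => rw [hqh t ht htv]
      simp
    simp only [sub_apply, smul_apply, smul_eq_mul, this]
    ring
  refine ⟨w, hwT, isExposed_convexHull_segment hvT hwT (l - l e • h) ?_ ?_ ?_, ?_⟩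
  · have := hm w hwT hwv
    rw [hwe] at this
    linarith
  · intro t ht
    by_cases htv : t = v
    · rw [htv]
    have h1 := hm t ht htv
    have h2 : l e ≤ l (q t) := by
      by_cases hte : q t = e
      · rw [hte]
      · exact (hl _ ⟨t, ⟨ht, htv⟩, rfl⟩ hte).le
    have := mul_nonneg (hpos t ht htv).le (sub_nonneg.2 h2)
    linarith
  · intro t ht hmt
    by_cases htv : t = v
    · rw [htv]; exact left_mem_segment ℝ v w
    have hte : q t = e := by
      by_contra hte
      have := mul_pos (hpos t ht htv) (sub_pos.2 (hl _ ⟨t, ⟨ht, htv⟩, rfl⟩ hte))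
      have := hm t ht htv
      linarith
    have hle : h t ≤ h w := by
      rcases le_total (h t) (h w) with hle | hle
      · exact hle
      · exact hwmax ⟨⟨ht, htv⟩, hte⟩ hle
    have hw0 := hpos w hwT hwv
    have hle' : h (t - v) ≤ h (w - v) := by simp only [map_sub]; linarith
    rw [segment_eq_image']
    refine ⟨h (t - v) / h (w - v), ⟨div_nonneg (hpos t ht htv).le hw0.le, (div_le_one hw0).2 hle'⟩,
      ?_⟩
    have h1 := hqh t ht htv
    have h2 := hqh w hwT hwv
    rw [hte] at h1
    rw [hwe] at h2
    have h3 : (h (t - v) / h (w - v)) • (w - v) = t - v :=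
      calc _ = (h (t - v) / h (w - v)) • (h (w - v) • e) := congrArg _ h2
        _ = t - v := by rw [smul_smul, div_mul_cancel₀ _ hw0.ne', ← h1]
    simp only [h3]; abel
  · have h2 : f (w - v) = h (w - v) * f e := by
      conv_lhs => rw [hqh w hwT hwv, hwe]
      simp
    have := mul_neg_of_pos_of_neg (hpos w hwT hwv) hfe
    rw [map_sub] at h2
    linarith

theorem left_mem_extremePoints_segment {E : Type*} [AddCommGroup E] [Module ℝ E] (a b : E) :
    a ∈ (segment ℝ a b).extremePoints ℝ := by
  rw [mem_extremePoints_iff_left]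
  refine ⟨left_mem_segment ℝ a b, fun x hx y hy hxy => ?_⟩
  rw [segment_eq_image'] at hx hy
  obtain ⟨s, hs, rfl⟩ := hx
  obtain ⟨t, ht, rfl⟩ := hy
  obtain ⟨α, β, hα, hβ, hαβ, h⟩ := hxy
  have h1 : (α * s + β * t) • (b - a) = 0 := by
    have h2 : a + (α * s + β * t) • (b - a) = a := by
      refine Eq.trans ?_ h
      obtain rfl : β = 1 - α := by linarith
      module
    simpa using h2
  rcases smul_eq_zero.1 h1 with h0 | h0
  · have h2 := mul_nonneg hα.le hs.1
    have h3 := mul_nonneg hβ.le ht.1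
    have h4 : α * s = 0 := by linarith
    rw [(mul_eq_zero.1 h4).resolve_left hα.ne']
    simp
  · simp [h0]

namespace IsEdge

variable {n : ℕ} {P : Set (Fin n → ℝ)} {a b : Fin n → ℤ}

theorem symm (h : IsEdge P a b) : IsEdge P b a :=
  ⟨h.1.symm, segment_symm ℝ (toR a) (toR b) ▸ h.2⟩

theorem left_isVertex (h : IsEdge P a b) : IsVertex P (toR a) :=
  h.2.isExtreme.extremePoints_subset_extremePoints (left_mem_extremePoints_segment _ _)

theorem left_mem (h : IsEdge P a b) : toR a ∈ P :=
  h.left_isVertex.1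

end IsEdge

theorem IsLatticePolytope.exists_isEdge_lt {n : ℕ} {P : Set (Fin n → ℝ)}
    (hP : IsLatticePolytope P) {v : Fin n → ℤ} (hv : IsVertex P (toR v))
    (f : (Fin n → ℝ) →L[ℝ] ℝ) {p : Fin n → ℝ} (hp : p ∈ P) (hfp : f p < f (toR v)) :
    ∃ w, IsEdge P v w ∧ f (toR w) < f (toR v) := by
  obtain ⟨S, rfl⟩ := hP
  obtain ⟨_, ⟨w, -, rfl⟩, hw, hfw⟩ :=
    exists_isExposed_segment_lt (S.finite_toSet.image toR) hv f hp hfp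
  exact ⟨w, ⟨by rintro rfl; exact hfw.false, hw⟩, hfw⟩

theorem IsLatticePolytope.exists_toR_eq {n : ℕ} {P : Set (Fin n → ℝ)}
    (hP : IsLatticePolytope P) {v : Fin n → ℝ} (hv : IsVertex P v) : ∃ w, toR w = v := by
  obtain ⟨S, rfl⟩ := hP
  obtain ⟨w, -, h⟩ := extremePoints_convexHull_subset hv
  exact ⟨w, h⟩

theorem IsLatticePolytope.le_of_forall_edge {n : ℕ} {P : Set (Fin n → ℝ)}
    (hP : IsLatticePolytope P) {v : Fin n → ℤ} (hv : IsVertex P (toR v))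
    {ι : Type*} {b : ι → Fin n → ℤ}
    (hb : ∀ c, IsEdge P v c →
      ∃ i, segment ℝ (toR v) (toR c) = segment ℝ (toR v) (toR (b i)))
    (f : (Fin n → ℝ) →L[ℝ] ℝ) (hf : ∀ i, f (toR v) ≤ f (toR (b i)))
    {x : Fin n → ℝ} (hx : x ∈ P) : f (toR v) ≤ f x := by
  by_contra! hlt
  obtain ⟨w, hw, hfw⟩ := hP.exists_isEdge_lt hv f hx hlt
  obtain ⟨i, hi⟩ := hb w hw
  have hwi : toR w ∈ segment ℝ (toR v) (toR (b i)) := hi ▸ right_mem_segment ℝ _ _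
  have hle : f (toR v) ≤ f (toR w) :=
    (convex_halfSpace_ge f.toLinearMap.isLinear _).segment_subset (le_refl (f (toR v))) (hf i) hwi
  exact hle.not_gt hfw

theorem latticeLength_dvd {n : ℕ} (v : Fin n → ℤ) (i : Fin n) : (latticeLength v : ℤ) ∣ v i :=
  Int.natCast_dvd.2 (Finset.gcd_dvd (Finset.mem_univ i))

theorem latticeLength_mul_primVec {n : ℕ} (v : Fin n → ℤ) (i : Fin n) :
    (latticeLength v : ℤ) * primVec v i = v i :=
  Int.mul_ediv_cancel' (latticeLength_dvd v i)

theorem latticeLength_pos {n : ℕ} {v : Fin n → ℤ} (hv : v ≠ 0) : 0 < latticeLength v := by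
  refine Nat.pos_of_ne_zero fun h => hv (funext fun i => ?_)
  rw [← latticeLength_mul_primVec v i, h]
  simp

theorem exists_dual_of_isUnit_det {n : ℕ} {v : Fin n → ℤ} {b : Fin n → Fin n → ℤ}
    (hbv : ∀ i, b i ≠ v) (hdet : IsUnit (Matrix.det (Matrix.of fun i => primVec (b i - v))))
    (m : Fin n) :
    ∃ c : (Fin n → ℝ) →L[ℝ] ℝ, c (toR v) < c (toR (b m)) ∧
      ∀ i, i ≠ m → c (toR (b i)) = c (toR v) := by
  set D : Matrix (Fin n) (Fin n) ℤ := Matrix.of fun i => primVec (b i - v) with hD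
  let c : (Fin n → ℝ) →L[ℝ] ℝ :=
    ∑ i, ((D⁻¹ i m : ℤ) : ℝ) • ContinuousLinearMap.proj (R := ℝ) (φ := fun _ : Fin n => ℝ) i
  have hc : ∀ i, c (toR (b i)) - c (toR v) =
      (latticeLength (b i - v) : ℝ) * ((1 : Matrix (Fin n) (Fin n) ℤ) i m : ℤ) := by
    intro i
    rw [← Matrix.mul_nonsing_inv D hdet, Matrix.mul_apply]
    simp only [c, sum_apply, smul_apply, ContinuousLinearMap.proj_apply, smul_eq_mul, toR,
      ← Finset.sum_sub_distrib, Int.cast_sum, Finset.mul_sum]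
    refine Finset.sum_congr rfl fun j _ => ?_
    have := latticeLength_mul_primVec (b i - v) j
    have h' : (latticeLength (b i - v) : ℝ) * (D i j : ℤ) = b i j - v j := by
      rw [hD]; exact_mod_cast this
    push_cast
    rw [← mul_assoc, h']
    ring
  refine ⟨c, ?_, fun i hi => ?_⟩
  · have := hc m
    have hL : (0 : ℝ) < latticeLength (b m - v) :=
      Nat.cast_pos.2 (latticeLength_pos (sub_ne_zero.2 (hbv m)))
    simp at this
    linarith
  · have := hc i
    rw [Matrix.one_apply_ne hi] at this
    simp at this
    linarith

theorem IsFacet.direction_eq_ker {n : ℕ} (hn : 1 ≤ n) {P F : Set (Fin n → ℝ)} (hF : IsFacet P F)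
    {c : (Fin n → ℝ) →L[ℝ] ℝ} (hc : c ≠ 0) {r : ℝ} (hcF : ∀ x ∈ F, c x = r) :
    (affineSpan ℝ F).direction = LinearMap.ker (c : (Fin n → ℝ) →ₗ[ℝ] ℝ) := by
  refine Submodule.eq_of_le_of_finrank_eq ?_ ?_
  · rw [direction_affineSpan, vectorSpan_def, Submodule.span_le]
    rintro _ ⟨x, hx, y, hy, rfl⟩
    simp [hcF x hx, hcF y hy]
  · have hc' : (c : Module.Dual ℝ (Fin n → ℝ)) ≠ 0 := by
      intro h
      exact hc (ContinuousLinearMap.coe_injective h)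
    have := Module.Dual.finrank_ker_add_one_of_ne_zero hc'
    rw [Module.finrank_fin_fun] at this
    rw [hF.2]
    omega

/-- At a smooth vertex on two distinct coordinate facets, every edge lies in one of them. -/
theorem edge_coord_eq_zero_or {n : ℕ} {P : Set (Fin n → ℝ)} (hP : IsLatticePolytope P)
    {v : Fin n → ℤ} (hv : IsVertex P (toR v)) {b : Fin n → Fin n → ℤ}
    (hbE : ∀ i, IsEdge P v (b i))
    (hb : ∀ c, IsEdge P v c →
      ∃ i, segment ℝ (toR v) (toR c) = segment ℝ (toR v) (toR (b i)))
    (hdet : IsUnit (Matrix.det (Matrix.of fun i => primVec (b i - v))))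
    {j j' : Fin n} (hjj' : j ≠ j') (hnonneg : ∀ x ∈ P, ∀ i, 0 ≤ x i)
    (hFj : IsFacet P (P ∩ {x | x j = 0})) (hFj' : IsFacet P (P ∩ {x | x j' = 0}))
    (hvj : v j = 0) (hvj' : v j' = 0) (m : Fin n) : b m j = 0 ∨ b m j' = 0 := by
  obtain ⟨c, hcm, hc⟩ := exists_dual_of_isUnit_det (fun i => (hbE i).1.symm) hdet m
  have hc0 : c ≠ 0 := by rintro rfl; simp at hcm
  have hcP : ∀ x ∈ P, c (toR v) ≤ c x := fun x hx =>
    hP.le_of_forall_edge hv hb c (fun i => by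
      by_cases hi : i = m
      · rw [hi]; exact hcm.le
      · exact (hc i hi).ge) hx
  have key : ∀ l : Fin n, IsFacet P (P ∩ {x | x l = 0}) → v l = 0 → b m l ≠ 0 →
      LinearMap.ker (c : (Fin n → ℝ) →ₗ[ℝ] ℝ) = LinearMap.ker (LinearMap.proj (R := ℝ)
        (φ := fun _ : Fin n => ℝ) l) := by
    intro l hF hvl hbl
    let p := ContinuousLinearMap.proj (R := ℝ) (φ := fun _ : Fin n => ℝ) l
    have hpv : p (toR v) = 0 := by simp [p, toR, hvl]
    have hpb : ∀ i, 0 ≤ p (toR (b i)) := fun i => hnonneg _ (hbE i).symm.left_mem l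
    have hpm : 0 < p (toR (b m)) := (hpb m).lt_of_ne' (by simpa [p, toR] using hbl)
    have hp0 : p ≠ 0 := fun h => by simp [h] at hpm
    rw [← hF.direction_eq_ker (by have := l.2; omega) hc0 (r := c (toR v))]
    · exact hF.direction_eq_ker (by have := l.2; omega) hp0 (r := 0) fun x hx => hx.2
    · rintro x ⟨hxP, hxl⟩
      refine le_antisymm ?_ (hcP x hxP)
      have hle := hP.le_of_forall_edge hv hb
        ((c (toR (b m)) - c (toR v)) • p - p (toR (b m)) • c) (fun i => by
          simp only [sub_apply, smul_apply, smul_eq_mul, hpv]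
          by_cases hi : i = m
          · rw [hi]; linarith
          · rw [hc i hi]
            nlinarith [mul_nonneg (sub_nonneg.2 hcm.le) (hpb i)]) hxP
      have hpx : p x = 0 := hxl
      simp only [sub_apply, smul_apply, smul_eq_mul, hpv, hpx, mul_zero, zero_sub] at hle
      exact le_of_mul_le_mul_left (neg_le_neg_iff.1 hle) hpm
  by_contra! hcon
  have h := (key j hFj hvj hcon.1).symm.trans (key j' hFj' hvj' hcon.2)
  have hmem : (Pi.single j' 1 : Fin n → ℝ) ∈ LinearMap.ker (LinearMap.proj (R := ℝ)
        (φ := fun _ : Fin n => ℝ) j) := by simp [hjj']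
  rw [h] at hmem
  simp at hmem

/-- The far endpoint of an edge along a nonnegative coordinate axis, seen from the origin. -/
theorem IsEdge.exists_single {n : ℕ} {P : Set (Fin n → ℝ)} (h0 : 0 ∈ P) {a b : Fin n → ℤ}
    (hab : IsEdge P a b) {i : Fin n}
    (hsub : segment ℝ (toR a) (toR b) ⊆ {x | 0 ≤ x i ∧ ∀ j, j ≠ i → x j = 0}) :
    ∃ m : ℤ, 0 < m ∧ IsEdge P 0 (Pi.single i m) := by
  wlog hlt : a i < b i generalizing a b
  · refine this hab.symm (segment_symm ℝ (toR a) (toR b) ▸ hsub) ((not_lt.1 hlt).lt_of_ne ?_)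
    intro heq
    refine hab.1 (funext fun j => ?_)
    by_cases hj : j = i
    · rw [hj, heq]
    · have h1 := (hsub (left_mem_segment ℝ _ _)).2 j hj
      have h2 := (hsub (right_mem_segment ℝ _ _)).2 j hj
      simp only [toR, Int.cast_eq_zero] at h1 h2
      rw [h1, h2]
  have single : ∀ z : Fin n → ℤ, toR z ∈ segment ℝ (toR a) (toR b) → z = Pi.single i (z i) := by
    intro z hz
    funext j
    by_cases hj : j = i
    · subst hj; simp
    · rw [Pi.single_eq_of_ne hj]
      simpa [toR] using (hsub hz).2 j hj
  have ha := single a (left_mem_segment ℝ _ _)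
  have hb := single b (right_mem_segment ℝ _ _)
  have ha0 : 0 ≤ a i := by simpa [toR] using (hsub (left_mem_segment ℝ _ _)).1
  have hai : a i = 0 := by
    by_contra hne
    have hapos : (0 : ℝ) < a i := by exact_mod_cast ha0.lt_of_ne' hne
    have hlt' : (a i : ℝ) < b i := by exact_mod_cast hlt
    have hbpos := hapos.trans hlt'
    have hmem : toR a ∈ openSegment ℝ (0 : Fin n → ℝ) (toR b) := by
      refine ⟨1 - a i / b i, a i / b i, sub_pos.2 ((div_lt_one hbpos).2 hlt'),
        div_pos hapos hbpos, by ring, ?_⟩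
      funext j
      by_cases hj : j = i
      · subst hj; simp [toR, hbpos.ne']
      · have h1 := (hsub (left_mem_segment ℝ _ _)).2 j hj
        have h2 := (hsub (right_mem_segment ℝ _ _)).2 j hj
        simp [h1, h2]
    have h0' := hab.2.isExtreme.left_mem_of_mem_openSegment h0 hab.symm.left_mem
      (left_mem_segment ℝ _ _) hmem
    have hge : segment ℝ (toR a) (toR b) ⊆ {x | (a i : ℝ) ≤ x i} :=
      (convex_halfSpace_ge (LinearMap.proj (R := ℝ) (φ := fun _ : Fin n => ℝ) i).isLinear
        _).segment_subset (le_refl (a i : ℝ)) hlt'.le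
    exact (hge h0').not_gt hapos
  refine ⟨b i, hai ▸ hlt, ?_⟩
  rw [hai, Pi.single_zero] at ha
  rw [← hb, ← ha]
  exact hab

theorem toR_zero {n : ℕ} : toR (0 : Fin n → ℤ) = 0 := by
  funext i; simp [toR]

theorem CanonicallyPositioned.nonneg {n : ℕ} {P : Set (Fin n → ℝ)}
    (hP : IsSmoothPolytope P) (hpos : CanonicallyPositioned P) {x : Fin n → ℝ} (hx : x ∈ P)
    (i : Fin n) : 0 ≤ x i := by
  have h0 : IsVertex P (toR 0) := toR_zero ▸ hpos.1
  have hax : ∀ i : Fin n, ∃ m : ℤ, 0 < m ∧ IsEdge P 0 (Pi.single i m) := fun i => by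
    obtain ⟨a, b, hab, hsub⟩ := hpos.2 i
    exact hab.exists_single hpos.1.1 hsub
  choose m hm hE using hax
  obtain ⟨b, -, -, hb, -⟩ := hP.2.2 0 h0
  choose σ hσ using fun i => hb _ (hE i)
  have hσinj : Function.Injective σ := by
    intro i l hil
    by_contra hne
    have hseg : segment ℝ (toR 0) (toR (Pi.single i (m i))) =
        segment ℝ (toR 0) (toR (Pi.single l (m l))) := by rw [hσ, hσ, hil]
    obtain ⟨α, β, -, -, -, h⟩ := hseg ▸ right_mem_segment ℝ (toR 0) (toR (Pi.single i (m i)))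
    have hi := congrFun h i
    simp [toR, hne] at hi
    exact (hm i).ne (by exact_mod_cast hi)
  have hσsurj := Finite.surjective_of_injective hσinj
  have hle := hP.1.le_of_forall_edge h0 (b := fun i => Pi.single i (m i)) (fun c hc => by
      obtain ⟨l, hl⟩ := hb c hc
      obtain ⟨t, rfl⟩ := hσsurj l
      exact ⟨t, hl.trans (hσ t).symm⟩)
    (ContinuousLinearMap.proj (R := ℝ) (φ := fun _ : Fin n => ℝ) i) (fun l => by
      have hnn : (0 : Fin n → ℤ) ≤ Pi.single l (m l) := Pi.single_nonneg.2 (hm l).le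
      simpa [toR] using hnn i) hx
  simpa [toR] using hle

theorem exists_ne_map_eq_of_forall_ne {n : ℕ} (g : Fin n → Fin n) (o : Fin n)
    (hg : ∀ j, g j ≠ o) : ∃ j j', j ≠ j' ∧ g j = g j' := by
  by_contra! hcon
  have hinj : Function.Injective g := fun j j' h => by
    by_contra hne
    exact hcon j j' hne h
  obtain ⟨j, hj⟩ := Finite.surjective_of_injective hinj o
  exact hg j hj

theorem IsCayley.of_coord_le {n k : ℕ} {P : Set (Fin n → ℝ)} (hP : IsLatticePolytope P)
    (hEdge : EdgesAtLeast P k) (h0 : 0 ∈ P) {i : Fin n}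
    (hi : ∀ x ∈ P, 0 ≤ x i ∧ x i ≤ (k : ℝ)) : IsCayley P k i := by
  refine ⟨hi, fun v hv => or_iff_not_imp_left.2 fun hv0 => ?_⟩
  obtain ⟨w, rfl⟩ := hP.exists_toR_eq hv
  have hpos : 0 < toR w i := (hi _ hv.1).1.lt_of_ne' hv0
  obtain ⟨u, hu, hlt⟩ := hP.exists_isEdge_lt hv
    (ContinuousLinearMap.proj (R := ℝ) (φ := fun _ : Fin n => ℝ) i) h0 (by simpa using hpos)
  have hlt' : u i < w i := by simpa [toR] using hlt
  have hu0 : 0 ≤ u i := by simpa [toR] using (hi _ hu.symm.left_mem).1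
  have hdvd : (latticeLength (u - w) : ℤ) ∣ w i - u i := by
    have := latticeLength_dvd (u - w) i
    rwa [← dvd_neg, Pi.sub_apply, neg_sub] at this
  have hle := Int.le_of_dvd (sub_pos.2 hlt') hdvd
  have hk : (k : ℤ) ≤ latticeLength (u - w) := by exact_mod_cast hEdge _ _ hu
  have hkw : (k : ℤ) ≤ w i := by linarith
  exact le_antisymm (hi _ hv.1).2 (by simp only [toR]; exact_mod_cast hkw)

theorem latticeLength_le_of_axis {n k : ℕ} {a b : Fin n → ℤ} {o : Fin n} (hab : a ≠ b)
    (hax : ∀ j, j ≠ o → a j = b j) (ha : 0 ≤ a o ∧ a o ≤ k) (hb : 0 ≤ b o ∧ b o ≤ k) :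
    latticeLength (b - a) ≤ k := by
  have hne : b o - a o ≠ 0 := fun h => hab (funext fun j => by
    by_cases hj : j = o
    · rw [hj]; linarith
    · exact hax j hj)
  have hdvd := latticeLength_dvd (b - a) o
  have hle := Int.le_of_dvd (abs_pos.2 hne) ((dvd_abs _ _).2 hdvd)
  have : |b o - a o| ≤ k := abs_le.2 ⟨by linarith, by linarith⟩
  exact_mod_cast hle.trans this

/-- (Claim 3.7 of the paper.) Let `P ⊂ ℝⁿ` (`n ≥ 2`) be a
full-dimensional smooth lattice polytope, canonically positioned, with every edge of
lattice length at least `k ≥ 1`, and such that for each `j` the set `Fⱼ = P ∩ {xⱼ = 0}`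
is a facet which is a Cayley polytope of order `k` with altitude in direction
`e_{i(j)}`, `i(j) ≠ j`. If the edge of `P` along the nonnegative `x₁`-axis has lattice
length strictly greater than `k`, then `P` is a Cayley polytope of order `k` with
altitude in some coordinate direction `eᵢ`. -/
theorem stmt_11 {n k : ℕ} (hn : 2 ≤ n) (hk : 1 ≤ k) (P : Set (Fin n → ℝ))
    (hP : IsSmoothPolytope P) (hpos : CanonicallyPositioned P)
    (hEdge : EdgesAtLeast P k)
    (g : Fin n → Fin n) (hg : ∀ j, g j ≠ j)
    (hFacet : ∀ j : Fin n, IsFacet P (P ∩ {x | x j = 0}))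
    (hCay : ∀ j : Fin n, IsCayley (P ∩ {x | x j = 0}) k (g j))
    (hlong : ∃ a b : Fin n → ℤ, IsEdge P a b ∧
      segment ℝ (toR a) (toR b) ⊆
        {x | 0 ≤ x ⟨0, by omega⟩ ∧ ∀ j, j ≠ (⟨0, by omega⟩ : Fin n) → x j = 0} ∧
      k < latticeLength (b - a)) :
    ∃ i : Fin n, (∀ x ∈ P, 0 ≤ x i ∧ x i ≤ (k : ℝ)) ∧ IsCayley P k i := by
  have h0 : (0 : Fin n → ℝ) ∈ P := hpos.1.1
  have hnn : ∀ x ∈ P, ∀ i, 0 ≤ x i := fun x hx i => hpos.nonneg hP hx i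
  have hg0 : ∀ j, g j ≠ ⟨0, by omega⟩ := by
    intro j hgj
    obtain ⟨a, b, hab, hsub, hlt⟩ := hlong
    have hj : j ≠ ⟨0, by omega⟩ := fun h => hg j (hgj.trans h.symm)
    have ha := hsub (left_mem_segment ℝ _ _)
    have hb := hsub (right_mem_segment ℝ _ _)
    have hka := (hCay j).1 _ ⟨hab.left_mem, ha.2 j hj⟩
    have hkb := (hCay j).1 _ ⟨hab.symm.left_mem, hb.2 j hj⟩
    rw [hgj] at hka hkb
    simp only [toR] at hka hkb
    refine hlt.not_ge (latticeLength_le_of_axis hab.1 (o := ⟨0, by omega⟩) (fun l hl => ?_)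
      (by exact_mod_cast hka) (by exact_mod_cast hkb))
    exact Int.cast_injective ((ha.2 l hl).trans (hb.2 l hl).symm)
  obtain ⟨j, j', hjj', hgg⟩ := exists_ne_map_eq_of_forall_ne g _ hg0
  have hj : j ≠ g j := (hg j).symm
  have hj' : j' ≠ g j := hgg ▸ (hg j').symm
  obtain ⟨a, b, hab, hsub⟩ := hpos.2 (g j)
  obtain ⟨m, hm, hE⟩ := hab.exists_single h0 hsub
  have hv : IsVertex P (toR (Pi.single (g j) m)) := hE.symm.left_isVertex
  have hvj : (Pi.single (g j) m : Fin n → ℤ) j = 0 := Pi.single_eq_of_ne hj _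
  have hvj' : (Pi.single (g j) m : Fin n → ℤ) j' = 0 := Pi.single_eq_of_ne hj' _
  have hmk : (m : ℝ) = k := by
    have hvF : IsVertex (P ∩ {x | x j = 0}) (toR (Pi.single (g j) m)) :=
      inter_extremePoints_subset_extremePoints_of_subset inter_subset_left
        ⟨⟨hv.1, by simp [toR, hvj]⟩, hv⟩
    rcases (hCay j).2 _ hvF with h | h
    · simp [toR] at h
      omega
    · simpa [toR] using h
  obtain ⟨c, -, hcE, hc, hdet⟩ := hP.2.2 _ hv
  have hle : ∀ x ∈ P, x (g j) ≤ k := by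
    intro x hx
    have := hP.1.le_of_forall_edge hv hc
      (-ContinuousLinearMap.proj (R := ℝ) (φ := fun _ : Fin n => ℝ) (g j)) (fun l => by
        have hcl : toR (c l) (g j) ≤ k := by
          have hmem := (hcE l).symm.left_mem
          rcases edge_coord_eq_zero_or hP.1 hv hcE hc hdet hjj' hnn (hFacet j) (hFacet j')
            hvj hvj' l with h | h
          · exact ((hCay j).1 _ ⟨hmem, by simp [toR, h]⟩).2
          · rw [hgg]
            exact ((hCay j').1 _ ⟨hmem, by simp [toR, h]⟩).2
        simpa [toR, hmk] using hcl) hx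
    simpa [toR, hmk] using this
  have hi : ∀ x ∈ P, 0 ≤ x (g j) ∧ x (g j) ≤ (k : ℝ) := fun x hx => ⟨hnn x hx _, hle x hx⟩
  exact ⟨g j, hi, IsCayley.of_coord_le hP.1 hEdge h0 hi⟩
end

section
/- Let k ≥ 1 be an integer, let P_0 ⊂ ℝ² be a 2-dimensional lattice polygon and P_1 ⊂ ℝ² a 1-dimensional lattice segment, and suppose that P := conv((P_0 × {0}) ∪ (P_1 × {k})) ⊂ ℝ³ is a full-dimensional smooth lattice polytope. Then P_0 has exactly 4 vertices, P has exactly 6 vertices, and P has exactly 5 facets. -/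
open Set

/-- Embedding of the plane `ℝ²` into `ℝ³` at height `c`. -/
def emb (c : ℝ) (x : Fin 2 → ℝ) : Fin 3 → ℝ := Fin.snoc x c

/-- A generator `t` of a pointed cone that is not generated by the other generators spans an
exposed ray. -/
lemma exists_functional_exposing_generator {n : ℕ} {T : Finset (Fin n → ℝ)} {t : Fin n → ℝ}
    (ht : t ∈ T) (h0 : (0 : Fin n → ℝ) ∉ convexHull ℝ (T : Set (Fin n → ℝ)))
    (hmin : t ∉ PointedCone.hull ℝ (T.erase t : Set (Fin n → ℝ))) :
    ∃ l : (Fin n → ℝ) →L[ℝ] ℝ, l t = 0 ∧ ∀ t' ∈ T, t' ≠ t → l t' < 0 := by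
  have hdisj : Disjoint (convexHull ℝ (T.erase t : Set (Fin n → ℝ)))
      (Submodule.span ℝ {t} : Set (Fin n → ℝ)) := by
    rw [Set.disjoint_left]
    intro x hx hxt
    obtain ⟨c, rfl⟩ := Submodule.mem_span_singleton.1 hxt
    rcases lt_or_ge 0 c with hc | hc
    · apply hmin
      have hsub : convexHull ℝ (T.erase t : Set (Fin n → ℝ)) ⊆
          (PointedCone.hull ℝ (T.erase t : Set (Fin n → ℝ)) : Set (Fin n → ℝ)) :=
        convexHull_min Submodule.subset_span (PointedCone.convex _)
      have h := Submodule.smul_mem _ (⟨c⁻¹, by positivity⟩ : {c : ℝ // 0 ≤ c}) (hsub hx)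
      rwa [Nonneg.mk_smul, smul_smul, inv_mul_cancel₀ hc.ne', one_smul] at h
    · apply h0
      have hx' : c • t ∈ convexHull ℝ (T : Set (Fin n → ℝ)) :=
        convexHull_mono (by simp) hx
      have ht' : t ∈ convexHull ℝ (T : Set (Fin n → ℝ)) := subset_convexHull ℝ _ ht
      have hpos : 0 < 1 - c := by linarith
      have h := convex_convexHull ℝ (T : Set (Fin n → ℝ)) hx' ht'
        (a := 1 / (1 - c)) (b := -c / (1 - c)) (by positivity)
        (div_nonneg (by linarith) hpos.le) (by field_simp; ring)
      convert h using 1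
      rw [smul_smul, ← add_smul]
      rw [show 1 / (1 - c) * c + -c / (1 - c) = 0 by ring, zero_smul]
  obtain ⟨l, u, v, hu, huv, hv⟩ := geometric_hahn_banach_compact_closed
    (convex_convexHull ℝ _) ((T.erase t).finite_toSet.isCompact_convexHull ℝ)
    (Submodule.convex (Submodule.span ℝ {t})) (Submodule.closed_of_finiteDimensional _) hdisj
  have hv0 : v < 0 := by simpa using hv 0 (Submodule.zero_mem _)
  have hlt : l t = 0 := by
    by_contra hne
    have h := hv (((v - 1) / l t) • t)
      (Submodule.smul_mem _ _ (Submodule.mem_span_singleton_self t))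
    rw [map_smul, smul_eq_mul, div_mul_cancel₀ _ hne] at h
    linarith
  refine ⟨l, hlt, fun t' ht' hne => ?_⟩
  have := hu t' (subset_convexHull ℝ _ (by simp [ht', hne]))
  linarith

/-- Every finite set contains an irredundant set of generators of the cone it generates. -/
lemma exists_irredundant_generators {n : ℕ} (T₀ : Finset (Fin n → ℝ)) :
    ∃ T ⊆ T₀, (∀ x ∈ T₀, x ∈ PointedCone.hull ℝ (T : Set (Fin n → ℝ))) ∧
      ∀ t ∈ T, t ∉ PointedCone.hull ℝ (T.erase t : Set (Fin n → ℝ)) := by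
  classical
  obtain ⟨T, hT, hmin⟩ := Finset.exists_min_image
    (T₀.powerset.filter fun T : Finset (Fin n → ℝ) => ∀ x ∈ T₀, x ∈ PointedCone.hull ℝ (T : Set (Fin n → ℝ)))
    Finset.card ⟨T₀, by
      simp only [Finset.mem_filter, Finset.mem_powerset, Finset.Subset.refl, true_and]
      exact fun x hx => Submodule.subset_span hx⟩
  simp only [Finset.mem_filter, Finset.mem_powerset] at hT hmin
  refine ⟨T, hT.1, hT.2, fun t ht hmem => ?_⟩
  have hle : PointedCone.hull ℝ (T : Set (Fin n → ℝ)) ≤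
      PointedCone.hull ℝ (T.erase t : Set (Fin n → ℝ)) := by
    refine Submodule.span_le.2 fun x hx => ?_
    by_cases hxt : x = t
    · exact hxt ▸ hmem
    · exact Submodule.subset_span (by simp [hxt] at hx ⊢; exact hx)
  have := hmin (T.erase t) ⟨(Finset.erase_subset _ _).trans hT.1, fun x hx => hle (hT.2 x hx)⟩
  have := Finset.card_erase_lt_of_mem ht
  omega

/-- `P` lies in a simplicial cone with apex `v` whose rays are spanned by points of `P`. -/
def HasSimplicialCone {n : ℕ} (P : Set (Fin n → ℝ)) (v : Fin n → ℝ) : Prop :=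
  ∃ e : Fin n → Fin n → ℝ, LinearIndependent ℝ e ∧ (∀ i, v + e i ∈ P) ∧
    ∀ x ∈ P, ∃ c : Fin n → ℝ, (∀ i, 0 ≤ c i) ∧ x = v + ∑ i, c i • e i

/-- A lattice polytope is contained in the cone spanned by its edges at a vertex. -/
lemma IsLatticePolytope.exists_edge_cone {n : ℕ} {P : Set (Fin n → ℝ)}
    (hP : IsLatticePolytope P) {w : Fin n → ℤ} (hw : IsVertex P (toR w)) :
    ∃ T : Finset (Fin n → ℝ),
      (∀ x ∈ P, x - toR w ∈ PointedCone.hull ℝ (T : Set (Fin n → ℝ))) ∧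
      ∀ t ∈ T, ∃ c : Fin n → ℤ, IsEdge P w c ∧ ∃ r : ℝ, 0 ≤ r ∧ t = r • (toR c - toR w) := by
  classical
  obtain ⟨S, rfl⟩ := hP
  set P := convexHull ℝ (toR '' (S : Set (Fin n → ℤ))) with hPdef
  have hPcpt : IsCompact P := (S.finite_toSet.image _).isCompact_convexHull ℝ
  have hPconv : Convex ℝ P := convex_convexHull ℝ _
  set T₀ : Finset (Fin n → ℝ) := (S.erase w).image fun s => toR s - toR w with hT₀
  have hinj : Function.Injective (toR (n := n)) := fun x y h => by
    funext i
    have := congrFun h i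
    exact_mod_cast (show (x i : ℝ) = y i from this)
  have h0 : (0 : Fin n → ℝ) ∉ convexHull ℝ (T₀ : Set (Fin n → ℝ)) := by
    intro h
    have h1 := ((hPconv.mem_extremePoints_iff_mem_sdiff_convexHull_sdiff).1 hw).2
    apply h1
    have h2 : (AffineEquiv.constVAdd ℝ (Fin n → ℝ) (toR w)).toAffineMap 0 ∈
        (AffineEquiv.constVAdd ℝ (Fin n → ℝ) (toR w)).toAffineMap ''
          convexHull ℝ (T₀ : Set (Fin n → ℝ)) := ⟨0, h, rfl⟩
    rw [AffineMap.image_convexHull] at h2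
    simp only [AffineEquiv.coe_toAffineMap, AffineEquiv.constVAdd_apply, vadd_eq_add,
      add_zero] at h2
    refine convexHull_mono ?_ h2
    rintro _ ⟨y, hy, rfl⟩
    simp only [hT₀, Finset.coe_image, Finset.coe_erase, Set.mem_image, Set.mem_sdiff,
      Finset.mem_coe, Set.mem_singleton_iff] at hy
    obtain ⟨s, ⟨hs, hsw⟩, rfl⟩ := hy
    simp only [add_sub_cancel]
    exact ⟨subset_convexHull ℝ _ ⟨s, hs, rfl⟩, fun h => hsw (hinj h)⟩
  obtain ⟨T, hTsub, hTgen, hTmin⟩ := exists_irredundant_generators T₀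
  have hcone : ∀ x ∈ P, x - toR w ∈ PointedCone.hull ℝ (T : Set (Fin n → ℝ)) := by
    intro x hx
    have hsub : P ⊆ (fun y => y - toR w) ⁻¹'
        (PointedCone.hull ℝ (T : Set (Fin n → ℝ)) : Set (Fin n → ℝ)) := by
      refine convexHull_min ?_ ?_
      · rintro _ ⟨s, hs, rfl⟩
        by_cases hsw : s = w
        · simp [hsw]
        · exact hTgen _ (Finset.mem_image.2 ⟨s, by simp [hsw]; exact hs, rfl⟩)
      · simp_rw [sub_eq_add_neg]
        exact (PointedCone.convex _).translate_preimage_left _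
    exact hsub hx
  refine ⟨T, hcone, fun t ht => ?_⟩
  obtain ⟨l, hlt, hlneg⟩ := exists_functional_exposing_generator ht
    (fun h => h0 (convexHull_mono (by exact_mod_cast hTsub) h)) (hTmin t ht)
  have ht0 : t ≠ 0 := fun h => h0 (subset_convexHull ℝ _ (hTsub (h ▸ ht)))
  have hray : ∀ x ∈ P, l x ≤ l (toR w) ∧
      (l (toR w) ≤ l x → ∃ c : ℝ, 0 ≤ c ∧ x = toR w + c • t) := by
    intro x hx
    obtain ⟨f, -, hf⟩ := Submodule.mem_span_finset.1 (hcone x hx)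
    have hsum : l x - l (toR w) = ∑ a ∈ T, (f a : ℝ) * l a := by
      rw [← map_sub, ← hf, map_sum]
      exact Finset.sum_congr rfl fun a _ => by
        rw [show f a • a = (f a : ℝ) • a from rfl, map_smul, smul_eq_mul]
    have hnonpos : ∀ a ∈ T, (f a : ℝ) * l a ≤ 0 := fun a ha => by
      by_cases hat : a = t
      · rw [hat, hlt, mul_zero]
      · exact mul_nonpos_of_nonneg_of_nonpos (f a).2 (hlneg a ha hat).le
    refine ⟨by linarith [Finset.sum_nonpos hnonpos], fun hle => ?_⟩
    have hzero := (Finset.sum_eq_zero_iff_of_nonpos hnonpos).1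
      (le_antisymm (Finset.sum_nonpos hnonpos) (by linarith))
    refine ⟨f t, (f t).2, ?_⟩
    rw [← sub_eq_iff_eq_add', ← hf]
    refine Finset.sum_eq_single_of_mem t ht fun a ha hat => ?_
    have : (f a : ℝ) = 0 := by
      rcases mul_eq_zero.1 (hzero a ha) with h | h
      · exact h
      · exact absurd h (hlneg a ha hat).ne
    rw [show f a • a = (f a : ℝ) • a from rfl, this, zero_smul]
  set F : Set (Fin n → ℝ) := {x ∈ P | ∀ y ∈ P, l y ≤ l x} with hF
  have hFexp : IsExposed ℝ P F := fun _ => ⟨l, rfl⟩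
  have hFmem : ∀ x, x ∈ F ↔ x ∈ P ∧ ∃ c : ℝ, 0 ≤ c ∧ x = toR w + c • t := by
    refine fun x => ⟨fun hx => ⟨hx.1, (hray x hx.1).2 (hx.2 _ hw.1)⟩, ?_⟩
    rintro ⟨hx, c, -, rfl⟩
    refine ⟨hx, fun y hy => ?_⟩
    rw [map_add, map_smul, hlt, smul_zero, add_zero]
    exact (hray y hy).1
  have hFt : toR w + t ∈ F := by
    refine (hFmem _).2 ⟨?_, 1, zero_le_one, by simp⟩
    obtain ⟨s, hs, hst⟩ := Finset.mem_image.1 (hTsub ht)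
    rw [← hst, add_sub_cancel]
    exact subset_convexHull ℝ _ ⟨s, Finset.mem_of_mem_erase hs, rfl⟩
  set h : (Fin n → ℝ) →L[ℝ] ℝ := ∑ i, t i • ContinuousLinearMap.proj i with hh
  have hht : 0 < h t := by
    have happ : h t = ∑ i, t i * t i := by simp [hh]
    rw [happ]
    obtain ⟨i, hi⟩ := Function.ne_iff.1 ht0
    exact Finset.sum_pos' (fun _ _ => mul_self_nonneg _) ⟨i, Finset.mem_univ _, mul_self_pos.2 hi⟩
  obtain ⟨x, hxF, hxmax⟩ := (hFexp.isCompact hPcpt).exists_isMaxOn ⟨_, hFt⟩ h.continuous.continuousOn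
  obtain ⟨hxP, c, hc, hxc⟩ := (hFmem x).1 hxF
  have hcle : ∀ c' : ℝ, toR w + c' • t ∈ F → c' ≤ c := by
    intro c' hc'
    have := hxmax hc'
    simp only [Set.mem_ofPred_eq, hxc, map_add, map_smul, smul_eq_mul] at this
    exact le_of_mul_le_mul_right (by linarith) hht
  have hc1 : 1 ≤ c := hcle 1 (by simpa using hFt)
  have hc0 : c ≠ 0 := (zero_lt_one.trans_le hc1).ne'
  have hxext : x ∈ Set.extremePoints ℝ F := by
    refine exposedPoints_subset_extremePoints ⟨hxF, h, fun y hy => ⟨hxmax hy, fun hle => ?_⟩⟩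
    obtain ⟨-, c', -, rfl⟩ := (hFmem y).1 hy
    have h1 := hcle c' hy
    simp only [hxc, map_add, map_smul, smul_eq_mul] at hle
    have h2 : c ≤ c' := le_of_mul_le_mul_right (by linarith) hht
    rw [hxc, le_antisymm h1 h2]
  obtain ⟨s, -, hsx⟩ := extremePoints_convexHull_subset
    (hFexp.isExtreme.extremePoints_subset_extremePoints hxext)
  have hseg : segment ℝ (toR w) (toR s) = F := by
    rw [hsx]
    apply Set.Subset.antisymm
    · have hwF : toR w ∈ F := (hFmem _).2 ⟨hw.1, 0, le_rfl, by simp⟩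
      exact (hFexp.convex hPconv).segment_subset hwF hxF
    · intro y hy
      obtain ⟨-, c', hc', rfl⟩ := (hFmem y).1 hy
      refine ⟨1 - c' / c, c' / c, ?_, by positivity, by ring, ?_⟩
      · have := div_le_one_of_le₀ (hcle c' hy) (by linarith)
        linarith
      · rw [hxc, smul_add, smul_smul, div_mul_cancel₀ _ hc0, ← add_assoc, ← add_smul,
          sub_add_cancel, one_smul]
  refine ⟨s, ⟨?_, hseg ▸ hFexp⟩, c⁻¹, by positivity, ?_⟩
  · rintro rfl
    have : c • t = 0 := by
      have := hsx.trans hxc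
      simpa using this
    exact ht0 ((smul_eq_zero.1 this).resolve_left hc0)
  · rw [hsx, hxc, add_sub_cancel_left, smul_smul, inv_mul_cancel₀ hc0, one_smul]

lemma IsSmoothPolytope.hasSimplicialCone {n : ℕ} {P : Set (Fin n → ℝ)} (hP : IsSmoothPolytope P)
    {v : Fin n → ℝ} (hv : v ∈ Set.extremePoints ℝ P) : HasSimplicialCone P v := by
  obtain ⟨hlat, -, hsm⟩ := hP
  obtain ⟨w, rfl⟩ : ∃ w, toR w = v := by
    obtain ⟨S, rfl⟩ := hlat
    obtain ⟨w, -, hw⟩ := extremePoints_convexHull_subset hv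
    exact ⟨w, hw⟩
  obtain ⟨b, -, hbe, hball, hdet⟩ := hsm w hv
  obtain ⟨T, hT, hTe⟩ := hlat.exists_edge_cone hv
  refine ⟨fun i => toR (b i) - toR w, ?_, fun i => ?_, fun x hx => ?_⟩
  · have hu : IsUnit ((Matrix.of fun i => primVec (b i - w)).map (Int.castRingHom ℝ)) := by
      rw [Matrix.isUnit_iff_isUnit_det, ← RingHom.mapMatrix_apply, ← RingHom.map_det]
      exact hdet.map _
    have hli := Matrix.linearIndependent_rows_iff_isUnit.2 hu
    have hlen : ∀ i, (latticeLength (b i - w) : ℝ) ≠ 0 := by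
      intro i h0
      have h1 : latticeLength (b i - w) = 0 := by exact_mod_cast h0
      apply (hbe i).1
      funext j
      have := Finset.gcd_eq_zero_iff.1 h1 j (Finset.mem_univ j)
      simp only [Pi.sub_apply, Int.natAbs_eq_zero] at this
      omega
    have := hli.units_smul (fun i => Units.mk0 _ (hlen i))
    refine (show (fun i => toR (b i) - toR w) = _ from ?_) ▸ this
    funext i j
    have hdvd : (latticeLength (b i - w) : ℤ) ∣ (b i - w) j :=
      Int.natCast_dvd.2 (Finset.gcd_dvd (Finset.mem_univ j))
    have : (latticeLength (b i - w) : ℤ) * primVec (b i - w) j = (b i - w) j :=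
      Int.mul_ediv_cancel' hdvd
    have hR : (latticeLength (b i - w) : ℝ) * (primVec (b i - w) j : ℝ) = ((b i - w) j : ℝ) := by
      exact_mod_cast this
    simp only [Pi.sub_apply, Int.cast_sub] at hR
    simpa [toR, Units.smul_def] using hR.symm
  · rw [add_sub_cancel]
    exact (hbe i).2.subset (right_mem_segment ℝ _ _)
  · have hle : PointedCone.hull ℝ (T : Set (Fin n → ℝ)) ≤
        PointedCone.hull ℝ (Set.range fun i => toR (b i) - toR w) := by
      refine Submodule.span_le.2 fun t ht => ?_
      obtain ⟨c, hc, r, hr, rfl⟩ := hTe t ht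
      obtain ⟨i, hi⟩ := hball c hc
      have hmem : toR c ∈ segment ℝ (toR w) (toR (b i)) := hi ▸ right_mem_segment ℝ _ _
      obtain ⟨p, q, -, hq, hpq, hcomb⟩ := hmem
      have heq : toR c - toR w = q • (toR (b i) - toR w) := by
        rw [← hcomb, ← eq_sub_iff_add_eq.2 hpq |>.symm]
        module
      rw [heq, smul_smul]
      exact Submodule.smul_mem _ (⟨r * q, mul_nonneg hr hq⟩ : {c : ℝ // 0 ≤ c})
        (Submodule.subset_span ⟨i, rfl⟩)
    obtain ⟨c, hc⟩ := Submodule.mem_span_range_iff_exists_fun _ |>.1 (hle (hT x hx))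
    refine ⟨fun i => c i, fun i => (c i).2, ?_⟩
    rw [← sub_eq_iff_eq_add', ← hc]
    rfl

/-- A strengthening of a supporting halfspace by a convex condition on its boundary hyperplane
is convex. -/
lemma convex_halfspace_and_face {E : Type*} [AddCommGroup E] [Module ℝ E] [TopologicalSpace E]
    (l : E →L[ℝ] ℝ) (μ : ℝ) {K : Set E} (hK : Convex ℝ K) :
    Convex ℝ {x | l x ≤ μ ∧ (l x = μ → x ∈ K)} := by
  rintro x ⟨hx, hxK⟩ y ⟨hy, hyK⟩ s t hs ht hst
  have hval : l (s • x + t • y) = s * l x + t * l y := by simp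
  have hs' : s * l x ≤ s * μ := mul_le_mul_of_nonneg_left hx hs
  have ht' : t * l y ≤ t * μ := mul_le_mul_of_nonneg_left hy ht
  have hμ : s * μ + t * μ = μ := by rw [← add_mul, hst, one_mul]
  refine ⟨by rw [hval]; linarith, fun h => ?_⟩
  rw [hval] at h
  rcases hs.eq_or_lt with rfl | hs0
  · obtain rfl : t = 1 := by linarith
    simpa using hyK (by linarith)
  rcases ht.eq_or_lt with rfl | ht0
  · obtain rfl : s = 1 := by linarith
    simpa using hxK (by linarith)
  exact hK (hxK (mul_left_cancel₀ hs0.ne' (by linarith)))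
    (hyK (mul_left_cancel₀ ht0.ne' (by linarith))) hs ht hst

lemma mem_extremePoints_convexHull_of_lex {n : ℕ} {s : Set (Fin n → ℝ)} {v : Fin n → ℝ}
    (hv : v ∈ s) (l h : (Fin n → ℝ) →L[ℝ] ℝ)
    (hs : ∀ x ∈ s, l x ≤ l v ∧ (l x = l v → h x ≤ h v ∧ (h x = h v → x = v))) :
    v ∈ Set.extremePoints ℝ (convexHull ℝ s) := by
  have hsub := convexHull_min (𝕜 := ℝ) (s := s) hs (convex_halfspace_and_face l (l v)
    (convex_halfspace_and_face h (h v) (convex_singleton v)))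
  have hvs := subset_convexHull ℝ s hv
  have hF : IsExposed ℝ (convexHull ℝ s) {x ∈ convexHull ℝ s | ∀ y ∈ convexHull ℝ s, l y ≤ l x} :=
    fun _ => ⟨l, rfl⟩
  refine hF.isExtreme.extremePoints_subset_extremePoints (exposedPoints_subset_extremePoints
    ⟨⟨hvs, fun y hy => (hsub hy).1⟩, h, fun y hy => ?_⟩)
  have hy' := (hsub hy.1).2 (le_antisymm (hsub hy.1).1 (hy.2 v hvs))
  exact ⟨hy'.1, fun hle => hy'.2 (le_antisymm hy'.1 hle)⟩

lemma linearIndependent_pair_of_triangular {E : Type*} [AddCommGroup E] [Module ℝ E]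
    [TopologicalSpace E] (φ ψ : E →L[ℝ] ℝ) {x y : E} (hx : φ x ≠ 0) (hψ : ψ x = 0)
    (hy : ψ y ≠ 0) : LinearIndependent ℝ ![x, y] := by
  refine LinearIndependent.pair_iff.2 fun s t hst => ?_
  have h1 : s * ψ x + t * ψ y = 0 := by simpa using congrArg ψ hst
  have h2 : s * φ x + t * φ y = 0 := by simpa using congrArg φ hst
  have ht : t = 0 := by simpa [hψ, hy] using h1
  exact ⟨by simpa [ht, hx] using h2, ht⟩

/-- In a simplicial cone, a face containing a two-dimensional set contains two of the rays. -/
lemma exists_two_rays_in_face {n : ℕ} [NeZero n] {P : Set (Fin n → ℝ)} {v : Fin n → ℝ}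
    {e : Fin n → Fin n → ℝ} (he : ∀ i, v + e i ∈ P)
    (hcone : ∀ x ∈ P, ∃ c : Fin n → ℝ, (∀ i, 0 ≤ c i) ∧ x = v + ∑ i, c i • e i)
    {l : (Fin n → ℝ) →L[ℝ] ℝ} (hl : ∀ x ∈ P, l x ≤ l v) {x y : Fin n → ℝ} (hx : x ∈ P)
    (hy : y ∈ P) (hlx : l x = l v) (hly : l y = l v)
    (hli : LinearIndependent ℝ ![x - v, y - v]) :
    ∃ i j, i ≠ j ∧ l (e i) = 0 ∧ l (e j) = 0 := by
  by_contra! hcon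
  obtain ⟨i, hi⟩ : ∃ i, ∀ j, j ≠ i → l (e j) ≠ 0 := by
    by_cases h : ∃ i, l (e i) = 0
    · obtain ⟨i, hi⟩ := h
      exact ⟨i, fun j hj => hcon i j hj.symm hi⟩
    · exact ⟨0, fun j _ hj => h ⟨j, hj⟩⟩
  have hle : ∀ j, l (e j) ≤ 0 := fun j => by
    have := hl _ (he j)
    rw [map_add] at this
    linarith
  have key : ∀ x ∈ P, l x = l v → ∃ r : ℝ, x - v = r • e i := by
    intro x hx hlx
    obtain ⟨c, hc, rfl⟩ := hcone x hx
    have hsum : ∑ j, c j * l (e j) = 0 := by simpa using hlx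
    have hz := (Finset.sum_eq_zero_iff_of_nonpos fun j _ =>
      mul_nonpos_of_nonneg_of_nonpos (hc j) (hle j)).1 hsum
    refine ⟨c i, ?_⟩
    rw [add_sub_cancel_left]
    refine Finset.sum_eq_single_of_mem i (Finset.mem_univ i) fun j _ hj => ?_
    rw [(mul_eq_zero.1 (hz j (Finset.mem_univ j))).resolve_right (hi j hj), zero_smul]
  obtain ⟨r, hr⟩ := key x hx hlx
  obtain ⟨r', hr'⟩ := key y hy hly
  have h := LinearIndependent.pair_iff.1 hli r' (-r) (by rw [hr, hr']; module)
  have h0 := hli.ne_zero 0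
  simp [hr, neg_eq_zero.1 h.2] at h0

/-- Projection of `ℝ³` to the first two coordinates. -/
def dropLast : (Fin 3 → ℝ) →L[ℝ] (Fin 2 → ℝ) :=
  ContinuousLinearMap.pi fun i => ContinuousLinearMap.proj i.castSucc

/-- The functional `(x, z) ↦ f x + c z` on `ℝ² × ℝ`. -/
noncomputable def cayleyFunctional (f : (Fin 2 → ℝ) →L[ℝ] ℝ) (c : ℝ) : (Fin 3 → ℝ) →L[ℝ] ℝ :=
  f.comp dropLast + c • ContinuousLinearMap.proj 2

@[simp] lemma emb_apply_two (c : ℝ) (x : Fin 2 → ℝ) : emb c x 2 = c :=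
  Fin.snoc_last (α := fun _ => ℝ) c x

@[simp] lemma dropLast_emb (c : ℝ) (x : Fin 2 → ℝ) : dropLast (emb c x) = x := by
  funext i
  exact Fin.snoc_castSucc (α := fun _ => ℝ) c x i

lemma eq_of_dropLast_eq {x y : Fin 3 → ℝ} (h : dropLast x = dropLast y) (h2 : x 2 = y 2) :
    x = y := by
  funext i
  fin_cases i
  · exact congrFun h 0
  · exact congrFun h 1
  · exact h2

lemma cayleyFunctional_apply (f : (Fin 2 → ℝ) →L[ℝ] ℝ) (c : ℝ) (x : Fin 3 → ℝ) :
    cayleyFunctional f c x = f (dropLast x) + c * x 2 := rfl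

@[simp] lemma cayleyFunctional_emb (f : (Fin 2 → ℝ) →L[ℝ] ℝ) (c t : ℝ) (x : Fin 2 → ℝ) :
    cayleyFunctional f c (emb t x) = f x + c * t := by
  simp [cayleyFunctional_apply]

lemma emb_injective (c : ℝ) : Function.Injective (emb c) := fun x y h => by
  simpa using congrArg dropLast h

lemma emb_combo (c : ℝ) (x y : Fin 2 → ℝ) {s t : ℝ} (h : s + t = 1) :
    s • emb c x + t • emb c y = emb c (s • x + t • y) := by
  apply eq_of_dropLast_eq
  · simp
  · simp [← add_mul, h]

lemma convex_image_emb {Q : Set (Fin 2 → ℝ)} (hQ : Convex ℝ Q) (c : ℝ) :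
    Convex ℝ (emb c '' Q) := by
  rintro _ ⟨x, hx, rfl⟩ _ ⟨y, hy, rfl⟩ s t hs ht hst
  exact ⟨_, hQ hx hy hs ht hst, (emb_combo c x y hst).symm⟩

lemma convex_preimage_emb {K : Set (Fin 3 → ℝ)} (hK : Convex ℝ K) (c : ℝ) :
    Convex ℝ (emb c ⁻¹' K) := by
  intro x hx y hy s t hs ht hst
  rw [Set.mem_preimage, ← emb_combo c x y hst]
  exact hK hx hy hs ht hst

/-- The Cayley polytope of `P₀` at height `0` and `P₁` at height `k`. -/
abbrev cayley (k : ℝ) (P₀ P₁ : Set (Fin 2 → ℝ)) : Set (Fin 3 → ℝ) :=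
  convexHull ℝ (emb 0 '' P₀ ∪ emb k '' P₁)

section Cayley

variable {k : ℝ} {P₀ P₁ : Set (Fin 2 → ℝ)} {x : Fin 3 → ℝ}

lemma emb_zero_mem_cayley {u : Fin 2 → ℝ} (hu : u ∈ P₀) : emb 0 u ∈ cayley k P₀ P₁ :=
  subset_convexHull ℝ _ (Or.inl ⟨u, hu, rfl⟩)

lemma emb_mem_cayley {u : Fin 2 → ℝ} (hu : u ∈ P₁) : emb k u ∈ cayley k P₀ P₁ :=
  subset_convexHull ℝ _ (Or.inr ⟨u, hu, rfl⟩)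

lemma cayley_subset {K : Set (Fin 3 → ℝ)} (hK : Convex ℝ K) (h0 : ∀ u ∈ P₀, emb 0 u ∈ K)
    (h1 : ∀ u ∈ P₁, emb k u ∈ K) : cayley k P₀ P₁ ⊆ K := by
  refine convexHull_min ?_ hK
  rintro _ (⟨u, hu, rfl⟩ | ⟨u, hu, rfl⟩)
  exacts [h0 u hu, h1 u hu]

lemma cayley_bottom (hk : 0 < k) (hP₀ : Convex ℝ P₀) (hx : x ∈ cayley k P₀ P₁) :
    0 ≤ x 2 ∧ (x 2 = 0 → x ∈ emb 0 '' P₀) := by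
  have h := cayley_subset (convex_halfspace_and_face (cayleyFunctional 0 (-1)) 0
    (convex_image_emb hP₀ 0)) (fun u hu => ⟨by simp, fun _ => ⟨u, hu, rfl⟩⟩)
    (fun u hu => ⟨by simp [hk.le], fun h => by simp [hk.ne'] at h⟩) hx
  simpa [cayleyFunctional_apply] using h

lemma cayley_top (hk : 0 < k) (hP₁ : Convex ℝ P₁) (hx : x ∈ cayley k P₀ P₁) :
    x 2 ≤ k ∧ (x 2 = k → x ∈ emb k '' P₁) := by
  have h := cayley_subset (convex_halfspace_and_face (cayleyFunctional 0 1) k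
    (convex_image_emb hP₁ k)) (fun u hu => ⟨by simp [hk.le], fun h => by simp [hk.ne] at h⟩)
    (fun u hu => ⟨by simp, fun _ => ⟨u, hu, rfl⟩⟩) hx
  simpa [cayleyFunctional_apply] using h

lemma mem_extremePoints_of_emb {c : ℝ} {Q : Set (Fin 2 → ℝ)} {P : Set (Fin 3 → ℝ)}
    {u : Fin 2 → ℝ} (hu : u ∈ Q) (hQ : ∀ u ∈ Q, emb c u ∈ P)
    (h : emb c u ∈ Set.extremePoints ℝ P) : u ∈ Set.extremePoints ℝ Q := by
  refine mem_extremePoints.2 ⟨hu, fun x hx y hy hxy => ?_⟩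
  obtain ⟨s, t, hs, ht, hst, rfl⟩ := hxy
  have := (mem_extremePoints.1 h).2 _ (hQ x hx) _ (hQ y hy)
    ⟨s, t, hs, ht, hst, emb_combo c x y hst⟩
  exact ⟨emb_injective c this.1, emb_injective c this.2⟩

lemma emb_mem_extremePoints {c : ℝ} {Q : Set (Fin 2 → ℝ)} {P : Set (Fin 3 → ℝ)}
    {u : Fin 2 → ℝ} (hu : u ∈ Set.extremePoints ℝ Q) (hP : emb c u ∈ P)
    (hface : ∀ x ∈ P, ∀ y ∈ P, emb c u ∈ openSegment ℝ x y → x ∈ emb c '' Q ∧ y ∈ emb c '' Q) :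
    emb c u ∈ Set.extremePoints ℝ P := by
  refine mem_extremePoints.2 ⟨hP, fun x hx y hy hxy => ?_⟩
  obtain ⟨⟨x', hx', rfl⟩, ⟨y', hy', rfl⟩⟩ := hface x hx y hy hxy
  obtain ⟨s, t, hs, ht, hst, h⟩ := hxy
  rw [emb_combo c x' y' hst] at h
  have := (mem_extremePoints.1 hu).2 x' hx' y' hy' ⟨s, t, hs, ht, hst, emb_injective c h⟩
  rw [this.1, this.2]
  exact ⟨rfl, rfl⟩

lemma extremePoints_cayley (hk : 0 < k) (hP₀ : Convex ℝ P₀) (hP₁ : Convex ℝ P₁) :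
    Set.extremePoints ℝ (cayley k P₀ P₁) =
      emb 0 '' Set.extremePoints ℝ P₀ ∪ emb k '' Set.extremePoints ℝ P₁ := by
  apply Set.Subset.antisymm
  · intro x hx
    rcases extremePoints_convexHull_subset hx with ⟨u, hu, rfl⟩ | ⟨u, hu, rfl⟩
    · exact Or.inl ⟨u, mem_extremePoints_of_emb hu (fun _ => emb_zero_mem_cayley) hx, rfl⟩
    · exact Or.inr ⟨u, mem_extremePoints_of_emb hu (fun _ => emb_mem_cayley) hx, rfl⟩
  · rintro _ (⟨u, hu, rfl⟩ | ⟨u, hu, rfl⟩)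
    · refine emb_mem_extremePoints hu (emb_zero_mem_cayley hu.1) fun x hx y hy hxy => ?_
      obtain ⟨s, t, hs, ht, -, h⟩ := hxy
      have hx' := cayley_bottom hk hP₀ hx
      have hy' := cayley_bottom hk hP₀ hy
      have h2 : s * x 2 + t * y 2 = 0 := by simpa using congrFun h 2
      have h3 : 0 ≤ s * x 2 := mul_nonneg hs.le hx'.1
      have h4 : 0 ≤ t * y 2 := mul_nonneg ht.le hy'.1
      exact ⟨hx'.2 (by simpa [hs.ne'] using (by linarith : s * x 2 = 0)),
        hy'.2 (by simpa [ht.ne'] using (by linarith : t * y 2 = 0))⟩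
    · refine emb_mem_extremePoints hu (emb_mem_cayley hu.1) fun x hx y hy hxy => ?_
      obtain ⟨s, t, hs, ht, hst, h⟩ := hxy
      have hx' := cayley_top hk hP₁ hx
      have hy' := cayley_top hk hP₁ hy
      have h2 : s * x 2 + t * y 2 = k := by simpa using congrFun h 2
      have h3 : s * x 2 ≤ s * k := mul_le_mul_of_nonneg_left hx'.1 hs.le
      have h4 : t * y 2 ≤ t * k := mul_le_mul_of_nonneg_left hy'.1 ht.le
      have h5 : s * k + t * k = k := by rw [← add_mul, hst, one_mul]
      exact ⟨hx'.2 (mul_left_cancel₀ hs.ne' (by linarith)),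
        hy'.2 (mul_left_cancel₀ ht.ne' (by linarith))⟩

/-- If all vertices are simple and `f` is constant on the segment `P₁`, then `f` does not attain
its maximum on `P₀` at a single vertex. -/
lemma not_unique_max_of_simple (hk : 0 < k) (hP₀ : Convex ℝ P₀) (hP₁ : Convex ℝ P₁)
    (hcone : ∀ v ∈ Set.extremePoints ℝ (cayley k P₀ P₁), HasSimplicialCone (cayley k P₀ P₁) v)
    {a b : Fin 2 → ℝ} (ha : a ∈ P₁) (hb : b ∈ P₁) (hab : a ≠ b)
    {f : (Fin 2 → ℝ) →L[ℝ] ℝ} (hf : ∀ x ∈ P₁, f x = f a) {v : Fin 2 → ℝ} (hv : v ∈ P₀)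
    (hmax : ∀ x ∈ P₀, f x ≤ f v) {x y : Fin 2 → ℝ} (hx : x ∈ P₀) (hy : y ∈ P₀)
    (hli : LinearIndependent ℝ ![x - v, y - v]) : ∃ x ∈ P₀, f x = f v ∧ x ≠ v := by
  by_contra! huniq
  have hvext : emb 0 v ∈ Set.extremePoints ℝ (cayley k P₀ P₁) := by
    rw [extremePoints_cayley hk hP₀ hP₁]
    exact Or.inl ⟨v, exposedPoints_subset_extremePoints ⟨hv, f, fun y hy =>
      ⟨hmax y hy, fun h => huniq y hy (le_antisymm (hmax y hy) h)⟩⟩, rfl⟩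
  obtain ⟨e, hei, heP, hec⟩ := hcone _ hvext
  set l := cayleyFunctional f ((f v - f a) / k) with hl
  have hlmax : ∀ x ∈ cayley k P₀ P₁, l x ≤ l (emb 0 v) := by
    intro x hx
    refine (cayley_subset (convex_halfspace_and_face l (l (emb 0 v)) convex_univ) ?_ ?_ hx).1
    · intro u hu
      simpa [hl] using hmax u hu
    · intro u hu
      simp [hl, div_mul_cancel₀ _ hk.ne', hf u hu]
  obtain ⟨i, j, hij, hi, hj⟩ := exists_two_rays_in_face heP hec
    (l := cayleyFunctional 0 (-1)) (x := emb 0 x) (y := emb 0 y)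
    (fun x hx => by simpa [cayleyFunctional_apply] using (cayley_bottom hk hP₀ hx).1)
    (emb_zero_mem_cayley hx) (emb_zero_mem_cayley hy) (by simp) (by simp)
    (LinearIndependent.pair_iff.2 fun s t hst => LinearIndependent.pair_iff.1 hli s t
      (by simpa using congrArg dropLast hst))
  obtain ⟨i', j', hij', hi', hj'⟩ := exists_two_rays_in_face heP hec
    (l := l) (x := emb k a) (y := emb k b) hlmax
    (emb_mem_cayley ha) (emb_mem_cayley hb) (by simp [hl, div_mul_cancel₀ _ hk.ne'])
    (by simp [hl, div_mul_cancel₀ _ hk.ne', hf b hb])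
    (LinearIndependent.pair_iff.2 fun s t hst => by
      have h2 : s * k + t * k = 0 := by simpa using congrFun hst 2
      have h3 : t = -s := by
        have : (s + t) * k = 0 := by linarith
        have := (mul_eq_zero.1 this).resolve_right hk.ne'
        linarith
      have h1 : s • (a - v) + t • (b - v) = 0 := by simpa using congrArg dropLast hst
      have h4 : s • (a - b) = 0 := by
        rw [← h1, h3]
        module
      have h5 := (smul_eq_zero.1 h4).resolve_right (sub_ne_zero.2 hab)
      exact ⟨h5, by rw [h3, h5, neg_zero]⟩)
  obtain ⟨r, hr, hr'⟩ : ∃ r, cayleyFunctional 0 (-1) (e r) = 0 ∧ l (e r) = 0 := by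
    have : ∀ i j i' j' : Fin 3, i ≠ j → i' ≠ j' → i = i' ∨ i = j' ∨ j = i' ∨ j = j' := by decide
    rcases this i j i' j' hij hij' with h | h | h | h <;> subst h
    exacts [⟨_, hi, hi'⟩, ⟨_, hi, hj'⟩, ⟨_, hj, hi'⟩, ⟨_, hj, hj'⟩]
  have hz : e r 2 = 0 := by simpa [cayleyFunctional_apply] using hr
  obtain ⟨u, hu, hue⟩ := (cayley_bottom hk hP₀ (heP r)).2 (by simp [hz])
  have hfu : f u = f v := by
    have h1 : l (emb 0 u) = l (emb 0 v) := by rw [hue, map_add, hr', add_zero]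
    simpa [hl] using h1
  rw [huniq u hu hfu] at hue
  exact hei.ne_zero r (by simpa using hue)

/-- At a simple vertex `a` of the segment `P₁`, the polytope lies on one side of the plane through
`a` and two vertices `p`, `q` of the edges of `P₀` parallel to `P₁`. -/
lemma le_cayleyFunctional_of_simple (hk : 0 < k) {a b p q : Fin 2 → ℝ}
    (hcone : HasSimplicialCone (cayley k P₀ P₁) (emb k a)) (hb : b ∈ P₁)
    (hp : p ∈ P₀) (hq : q ∈ P₀)
    {f g : (Fin 2 → ℝ) →L[ℝ] ℝ} (hfg : ∀ x, f x = 0 → g x = 0 → x = 0)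
    (hf : ∀ x ∈ P₁, f x = f a) (hg : ∀ x ∈ P₁, g a ≤ g x) (hab : g a < g b) (hpq : f p < f q)
    (hfP₀ : ∀ x ∈ P₀, f p ≤ f x ∧ f x ≤ f q) (hgp : ∀ x ∈ P₀, f x = f p → g p ≤ g x)
    (hgq : ∀ x ∈ P₀, f x = f q → g q ≤ g x) {u w c : ℝ} (hpc : g p + u * f p = c)
    (hqc : g q + u * f q = c) (hac : g a + u * f a + w * k = c) :
    ∀ x ∈ cayley k P₀ P₁, c ≤ cayleyFunctional (g + u • f) w x := by
  obtain ⟨e, hei, heP, hec⟩ := hcone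
  set L := cayleyFunctional (g + u • f) w with hL
  set l₁ := cayleyFunctional (-f) ((f a - f p) / k) with hl₁
  set l₂ := cayleyFunctional f ((f q - f a) / k) with hl₂
  have hK : Convex ℝ {x | c ≤ L x} := convex_halfSpace_ge L.isLinear c
  have hP₁L : ∀ x ∈ P₁, c ≤ L (emb k x) := by
    intro x hx
    have := hg x hx
    simp only [hL, cayleyFunctional_emb, add_apply,
      smul_apply, smul_eq_mul, hf x hx]
    linarith
  have h₁ : cayley k P₀ P₁ ⊆ {x | l₁ x ≤ -f p ∧ (l₁ x = -f p → c ≤ L x)} := by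
    refine cayley_subset (convex_halfspace_and_face l₁ _ hK) (fun x hx => ⟨?_, fun h => ?_⟩)
      fun x hx => ⟨?_, fun _ => hP₁L x hx⟩
    · simpa [hl₁] using (hfP₀ x hx).1
    · have h' : f x = f p := by simpa [hl₁] using h
      have := hgp x hx h'
      simp only [hL, cayleyFunctional_emb, add_apply,
        smul_apply, smul_eq_mul, h']
      linarith
    · simp [hl₁, div_mul_cancel₀ _ hk.ne', hf x hx]
  have h₂ : cayley k P₀ P₁ ⊆ {x | l₂ x ≤ f q ∧ (l₂ x = f q → c ≤ L x)} := by
    refine cayley_subset (convex_halfspace_and_face l₂ _ hK) (fun x hx => ⟨?_, fun h => ?_⟩)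
      fun x hx => ⟨?_, fun _ => hP₁L x hx⟩
    · simpa [hl₂] using (hfP₀ x hx).2
    · have h' : f x = f q := by simpa [hl₂] using h
      have := hgq x hx h'
      simp only [hL, cayleyFunctional_emb, add_apply,
        smul_apply, smul_eq_mul, h']
      linarith
    · simp [hl₂, div_mul_cancel₀ _ hk.ne', hf x hx]
  have ha₁ : l₁ (emb k a) = -f p := by
    simp only [hl₁, cayleyFunctional_emb, neg_apply, div_mul_cancel₀ _ hk.ne']
    ring
  have ha₂ : l₂ (emb k a) = f q := by simp [hl₂, div_mul_cancel₀ _ hk.ne']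
  have haL : L (emb k a) = c := by simp [hL, ← hac]
  have hli : ∀ r : Fin 2 → ℝ, LinearIndependent ℝ ![emb k b - emb k a, emb 0 r - emb k a] :=
    fun r => linearIndependent_pair_of_triangular (cayleyFunctional g 0) (cayleyFunctional 0 1)
      (by simpa using (sub_pos.2 hab).ne') (by simp) (by simp [hk.ne'])
  obtain ⟨i, j, hij, hi, hj⟩ := exists_two_rays_in_face heP hec (l := l₁)
    (fun x hx => ha₁ ▸ (h₁ hx).1) (emb_mem_cayley hb) (emb_zero_mem_cayley hp)
    (by simp [hl₁, div_mul_cancel₀ _ hk.ne', hf b hb]) (by rw [ha₁]; simp [hl₁]) (hli p)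
  obtain ⟨i', j', hij', hi', hj'⟩ := exists_two_rays_in_face heP hec (l := l₂)
    (fun x hx => ha₂ ▸ (h₂ hx).1) (emb_mem_cayley hb) (emb_zero_mem_cayley hq)
    (by simp [hl₂, div_mul_cancel₀ _ hk.ne', hf b hb]) (by rw [ha₂]; simp [hl₂]) (hli q)
  have hpar : ∀ r, l₁ (e r) = 0 → l₂ (e r) = 0 → e r 2 = 0 ∧ f (dropLast (e r)) = 0 := by
    intro r hr₁ hr₂
    simp only [hl₁, hl₂, cayleyFunctional_apply, neg_apply] at hr₁ hr₂
    have hz : (f q - f p) * (e r 2 / k) = 0 := by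
      have : (f q - f p) * (e r 2 / k) =
        (f a - f p) / k * e r 2 + (f q - f a) / k * e r 2 := by ring
      linarith
    have hz' : e r 2 = 0 := by
      have := (mul_eq_zero.1 hz).resolve_left (sub_pos.2 hpq).ne'
      exact (div_eq_zero_iff.1 this).resolve_right hk.ne'
    exact ⟨hz', by simpa [hz'] using hr₂⟩
  have huniq : ∀ r s, r ≠ s → ¬ (l₁ (e r) = 0 ∧ l₂ (e r) = 0 ∧ l₁ (e s) = 0 ∧ l₂ (e s) = 0) := by
    rintro r s hrs ⟨hr₁, hr₂, hs₁, hs₂⟩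
    obtain ⟨hrz, hrf⟩ := hpar r hr₁ hr₂
    obtain ⟨hsz, hsf⟩ := hpar s hs₁ hs₂
    have hpair : LinearIndependent ℝ ![e r, e s] := by
      have hinj : Function.Injective ![r, s] := by
        intro x y hxy
        fin_cases x <;> fin_cases y <;> simp_all
      convert hei.comp _ hinj using 1
      funext x
      fin_cases x <;> rfl
    have hgr : ∀ t, e t 2 = 0 → f (dropLast (e t)) = 0 → g (dropLast (e t)) ≠ 0 := by
      intro t htz htf htg
      exact hei.ne_zero t (eq_of_dropLast_eq (by simp [hfg _ htf htg]) (by simpa using htz))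
    have hcomb : g (dropLast (e s)) • e r + (-g (dropLast (e r))) • e s = 0 := by
      apply eq_of_dropLast_eq
      · rw [map_zero]
        apply hfg
        · simp [hrf, hsf]
        · simp only [map_add, map_smul, smul_eq_mul]
          ring
      · simp [hrz, hsz]
    exact hgr s hsz hsf (LinearIndependent.pair_iff.1 hpair _ _ hcomb).1
  have hcover : ∀ r, l₁ (e r) = 0 ∨ l₂ (e r) = 0 := by
    intro r
    by_contra! hr
    have hfin : ∀ i j i' j' r : Fin 3, i ≠ j → i' ≠ j' → i ≠ r → j ≠ r → i' ≠ r → j' ≠ r →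
        (i = i' ∧ j = j') ∨ (i = j' ∧ j = i') := by decide
    have hne₁ : ∀ s, l₁ (e s) = 0 → s ≠ r := fun s hs h => hr.1 (h ▸ hs)
    have hne₂ : ∀ s, l₂ (e s) = 0 → s ≠ r := fun s hs h => hr.2 (h ▸ hs)
    rcases hfin i j i' j' r hij hij' (hne₁ i hi) (hne₁ j hj) (hne₂ i' hi') (hne₂ j' hj') with
      ⟨rfl, rfl⟩ | ⟨rfl, rfl⟩
    · exact huniq i j hij ⟨hi, hi', hj, hj'⟩
    · exact huniq i j hij ⟨hi, hj', hj, hi'⟩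
  have hLe : ∀ r, 0 ≤ L (e r) := by
    intro r
    have : c ≤ L (emb k a + e r) := by
      rcases hcover r with hr | hr
      · exact (h₁ (heP r)).2 (by rw [map_add, hr, ha₁, add_zero])
      · exact (h₂ (heP r)).2 (by rw [map_add, hr, ha₂, add_zero])
    rw [map_add, haL] at this
    linarith
  intro x hx
  obtain ⟨d, hd, rfl⟩ := hec x hx
  rw [map_add, haL, map_sum]
  have : 0 ≤ ∑ r, L (d r • e r) := Finset.sum_nonneg fun r _ => by
    rw [map_smul]
    exact mul_nonneg (hd r) (hLe r)
  linarith

end Cayley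

lemma IsFullDim.exists_ne {n : ℕ} {P : Set (Fin n → ℝ)} (hP : IsFullDim P)
    {f : (Fin n → ℝ) →L[ℝ] ℝ} (hf : f ≠ 0) (v : Fin n → ℝ) : ∃ x ∈ P, f x ≠ f v := by
  by_contra! h
  apply hf
  have hle : vectorSpan ℝ P ≤ LinearMap.ker (f : (Fin n → ℝ) →ₗ[ℝ] ℝ) := by
    refine Submodule.span_le.2 ?_
    rintro _ ⟨x, hx, y, hy, rfl⟩
    simp [h x hx, h y hy]
  rw [← direction_affineSpan, hP, AffineSubspace.direction_top] at hle
  ext1 x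
  exact hle (Submodule.mem_top (x := x))

lemma IsFullDim.exists_linearIndependent {P : Set (Fin 2 → ℝ)} (hP : IsFullDim P)
    (v : Fin 2 → ℝ) : ∃ x ∈ P, ∃ y ∈ P, LinearIndependent ℝ ![x - v, y - v] := by
  have hne : (ContinuousLinearMap.proj 0 : (Fin 2 → ℝ) →L[ℝ] ℝ) ≠ 0 := fun h => by
    simpa using congrArg (fun l => l (fun _ => 1)) h
  obtain ⟨x, hx, hxv⟩ := hP.exists_ne hne v
  have hxv' : x 0 - v 0 ≠ 0 := sub_ne_zero.2 hxv
  set ψ : (Fin 2 → ℝ) →L[ℝ] ℝ := (x 0 - v 0) • ContinuousLinearMap.proj 1 -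
    (x 1 - v 1) • ContinuousLinearMap.proj 0 with hψ
  have hψ0 : ψ ≠ 0 := fun h => by
    have := congrArg (fun l => l ![0, 1]) h
    exact hxv' (by simpa [hψ] using this)
  obtain ⟨y, hy, hyv⟩ := hP.exists_ne hψ0 v
  refine ⟨x, hx, y, hy, linearIndependent_pair_of_triangular (ContinuousLinearMap.proj 0) ψ
    hxv' ?_ (by rwa [map_sub, sub_ne_zero])⟩
  simp only [hψ, sub_apply, smul_apply, ContinuousLinearMap.proj_apply,
    Pi.sub_apply, smul_eq_mul]
  ring

lemma exists_perp_and_dot {d : Fin 2 → ℝ} (hd : d ≠ 0) :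
    ∃ f g : (Fin 2 → ℝ) →L[ℝ] ℝ, f d = 0 ∧ 0 < g d ∧ f ≠ 0 ∧ ∀ x, f x = 0 → g x = 0 → x = 0 := by
  have hpos : 0 < d 0 * d 0 + d 1 * d 1 := by
    by_contra! h
    apply hd
    have h0 := mul_self_nonneg (d 0)
    have h1 := mul_self_nonneg (d 1)
    have e0 : d 0 = 0 := mul_self_eq_zero.1 (by linarith)
    have e1 : d 1 = 0 := mul_self_eq_zero.1 (by linarith)
    funext i
    fin_cases i
    exacts [e0, e1]
  refine ⟨d 0 • ContinuousLinearMap.proj 1 - d 1 • ContinuousLinearMap.proj 0,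
    d 0 • ContinuousLinearMap.proj 0 + d 1 • ContinuousLinearMap.proj 1, ?_, ?_, ?_, ?_⟩
  · simp [mul_comm]
  · simpa using hpos
  · intro h
    have := congrArg (fun l => l ![-d 1, d 0]) h
    simp at this
    linarith
  · intro x hf hg
    simp only [sub_apply, add_apply, smul_apply, ContinuousLinearMap.proj_apply,
      smul_eq_mul] at hf hg
    have h0 : (d 0 * d 0 + d 1 * d 1) * x 0 = 0 := by linear_combination d 0 * hg - d 1 * hf
    have h1 : (d 0 * d 0 + d 1 * d 1) * x 1 = 0 := by linear_combination d 1 * hg + d 0 * hf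
    funext i
    fin_cases i
    · exact (mul_eq_zero.1 h0).resolve_left hpos.ne'
    · exact (mul_eq_zero.1 h1).resolve_left hpos.ne'

lemma IsLatticePolytope.isCompact {n : ℕ} {P : Set (Fin n → ℝ)} (hP : IsLatticePolytope P) :
    IsCompact P := by
  obtain ⟨S, rfl⟩ := hP
  exact (S.finite_toSet.image _).isCompact_convexHull ℝ

lemma IsLatticePolytope.convex {n : ℕ} {P : Set (Fin n → ℝ)} (hP : IsLatticePolytope P) :
    Convex ℝ P := by
  obtain ⟨S, rfl⟩ := hP
  exact convex_convexHull ℝ _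

lemma mem_segment_of_functionals {n : ℕ} {f g : (Fin n → ℝ) →L[ℝ] ℝ}
    (hfg : ∀ x, f x = 0 → g x = 0 → x = 0) {x y z : Fin n → ℝ} (hy : f y = f x) (hz : f z = f x)
    (hgy : g y ≤ g x) (hgz : g x ≤ g z) : x ∈ segment ℝ y z := by
  rcases (hgy.trans hgz).eq_or_lt with h | h
  · have : x = y := sub_eq_zero.1 (hfg _ (by simp [hy]) (by rw [map_sub]; linarith))
    exact this ▸ left_mem_segment ℝ _ _
  · have hpos : 0 < g z - g y := sub_pos.2 h
    refine ⟨(g z - g x) / (g z - g y), (g x - g y) / (g z - g y),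
      div_nonneg (by linarith) hpos.le, div_nonneg (by linarith) hpos.le, by field_simp; ring, ?_⟩
    refine sub_eq_zero.1 (hfg _ ?_ ?_)
    · simp only [map_sub, map_add, map_smul, hy, hz, smul_eq_mul]
      field_simp
      ring
    · simp only [map_sub, map_add, map_smul, smul_eq_mul]
      field_simp
      ring

lemma exists_eq_segment {n : ℕ} {Q : Set (Fin n → ℝ)} (hcpt : IsCompact Q) (hconv : Convex ℝ Q)
    (hdim : Module.finrank ℝ (affineSpan ℝ Q).direction = 1) :
    ∃ a b, a ≠ b ∧ Q = segment ℝ a b := by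
  have hne : Q.Nonempty := by
    by_contra! h
    rw [h, direction_affineSpan, vectorSpan_empty, finrank_bot] at hdim
    exact zero_ne_one hdim
  obtain ⟨⟨d, hdmem⟩, hd0, hd⟩ := finrank_eq_one_iff'.1 hdim
  replace hd0 : d ≠ 0 := fun h => hd0 (Subtype.ext h)
  obtain ⟨i, hi⟩ := Function.ne_iff.1 hd0
  have hdiff : ∀ x ∈ Q, ∀ y ∈ Q, ∃ c : ℝ, x - y = c • d := fun x hx y hy => by
    obtain ⟨c, hc⟩ := hd ⟨x -ᵥ y, AffineSubspace.vsub_mem_direction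
      (subset_affineSpan ℝ Q hx) (subset_affineSpan ℝ Q hy)⟩
    exact ⟨c, (congrArg Subtype.val hc).symm⟩
  obtain ⟨a, ha, hamin⟩ := hcpt.exists_isMinOn hne (continuous_apply i).continuousOn
  obtain ⟨b, hb, hbmax⟩ := hcpt.exists_isMaxOn hne (continuous_apply i).continuousOn
  have hsub : Q ⊆ segment ℝ a b := by
    intro x hx
    obtain ⟨c, hc⟩ := hdiff x hx a ha
    obtain ⟨c', hc'⟩ := hdiff b hb a ha
    have h1 : x i - a i = c * d i := congrFun hc i
    have h2 : b i - a i = c' * d i := congrFun hc' i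
    have h3 : a i ≤ x i := hamin hx
    have h4 : x i ≤ b i := hbmax hx
    rcases (h3.trans h4).eq_or_lt with h | h
    · have hc0 : c = 0 := (mul_eq_zero.1 (by linarith : c * d i = 0)).resolve_right hi
      rw [hc0, zero_smul, sub_eq_zero] at hc
      exact hc ▸ left_mem_segment ℝ _ _
    · have hpos : 0 < b i - a i := sub_pos.2 h
      have hc'0 : c' ≠ 0 := by
        rintro rfl
        linarith
      have hr : (x i - a i) / (b i - a i) = c / c' := by
        rw [h1, h2, mul_div_mul_right _ _ hi]
      refine ⟨1 - c / c', c / c', ?_, ?_, by ring, ?_⟩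
      · rw [← hr, sub_nonneg]
        exact div_le_one_of_le₀ (by linarith) hpos.le
      · rw [← hr]
        exact div_nonneg (by linarith) hpos.le
      · rw [eq_add_of_sub_eq hc, eq_add_of_sub_eq hc', smul_add, smul_smul,
          div_mul_cancel₀ _ hc'0]
        module
  refine ⟨a, b, ?_, hsub.antisymm (hconv.segment_subset ha hb)⟩
  rintro rfl
  rw [segment_same] at hsub
  have hQ : Q = {a} := hsub.antisymm (Set.singleton_subset_iff.2 ha)
  rw [hQ, direction_affineSpan, vectorSpan_singleton, finrank_bot] at hdim
  exact zero_ne_one hdim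

/-- If all vertices are simple, the face of `P₀` maximising a functional `f` that is constant on
`P₁` is an edge. -/
lemma exists_parallel_edge {k : ℝ} {P₀ P₁ : Set (Fin 2 → ℝ)} (hk : 0 < k) (hP₀ : Convex ℝ P₀)
    (hP₁ : Convex ℝ P₁) (hcpt : IsCompact P₀) (hfull : IsFullDim P₀)
    (hcone : ∀ v ∈ Set.extremePoints ℝ (cayley k P₀ P₁), HasSimplicialCone (cayley k P₀ P₁) v)
    {a b : Fin 2 → ℝ} (ha : a ∈ P₁) (hb : b ∈ P₁) (hab : a ≠ b)
    {f g : (Fin 2 → ℝ) →L[ℝ] ℝ} (hf : ∀ x ∈ P₁, f x = f a)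
    (hfg : ∀ x, f x = 0 → g x = 0 → x = 0) :
    ∃ p ∈ P₀, ∃ q ∈ P₀, (∀ x ∈ P₀, f x ≤ f p) ∧ f q = f p ∧ g p < g q ∧
      ∀ x ∈ P₀, f x = f p → g p ≤ g x ∧ g x ≤ g q := by
  obtain ⟨x₀, hx₀, -⟩ := hfull.exists_linearIndependent 0
  obtain ⟨r, hr, hrmax⟩ := hcpt.exists_isMaxOn ⟨x₀, hx₀⟩ f.continuous.continuousOn
  have hFcpt : IsCompact (P₀ ∩ {x | f x = f r}) :=
    hcpt.inter_right (isClosed_eq f.continuous continuous_const)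
  obtain ⟨p, ⟨hp, hpr⟩, hpmin⟩ :=
    hFcpt.exists_isMinOn ⟨r, hr, rfl⟩ g.continuous.continuousOn
  obtain ⟨q, ⟨hq, hqr⟩, hqmax⟩ :=
    hFcpt.exists_isMaxOn ⟨r, hr, rfl⟩ g.continuous.continuousOn
  simp only [Set.mem_ofPred_eq] at hpr hqr
  have hmax : ∀ x ∈ P₀, f x ≤ f p := fun x hx => hpr ▸ hrmax hx
  have hbd : ∀ x ∈ P₀, f x = f p → g p ≤ g x ∧ g x ≤ g q := fun x hx h =>
    ⟨hpmin ⟨hx, h.trans hpr⟩, hqmax ⟨hx, h.trans hpr⟩⟩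
  refine ⟨p, hp, q, hq, hmax, hqr.trans hpr.symm, ?_, hbd⟩
  obtain ⟨x, hx, y, hy, hli⟩ := hfull.exists_linearIndependent p
  obtain ⟨z, hz, hzp, hne⟩ :=
    not_unique_max_of_simple hk hP₀ hP₁ hcone ha hb hab hf hp hmax hx hy hli
  obtain ⟨h1, h2⟩ := hbd z hz hzp
  refine (h1.trans h2).lt_of_ne fun h => hne (sub_eq_zero.1 (hfg _ ?_ ?_))
  · rw [map_sub, hzp, sub_self]
  · rw [map_sub]
    linarith

lemma isFacet_of_supporting {P : Set (Fin 3 → ℝ)} {l : (Fin 3 → ℝ) →L[ℝ] ℝ} {μ : ℝ}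
    (hl : ∀ x ∈ P, l x ≤ μ) {w x y z : Fin 3 → ℝ} (hw : l w ≠ μ) (hx : x ∈ P) (hxμ : l x = μ)
    (hy : y ∈ P) (hyμ : l y = μ) (hz : z ∈ P) (hzμ : l z = μ)
    (hli : LinearIndependent ℝ ![y - x, z - x]) : IsFacet P {x ∈ P | l x = μ} := by
  refine ⟨fun _ => ⟨l, ?_⟩, le_antisymm ?_ ?_⟩
  · ext v
    refine ⟨fun hv => ⟨hv.1, fun u hu => (hl u hu).trans hv.2.ge⟩, fun hv => ⟨hv.1, ?_⟩⟩
    exact le_antisymm (hl v hv.1) (hxμ ▸ hv.2 x hx)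
  · have hle : (affineSpan ℝ {x ∈ P | l x = μ}).direction ≤
        LinearMap.ker (l : (Fin 3 → ℝ) →ₗ[ℝ] ℝ) := by
      rw [direction_affineSpan]
      refine Submodule.span_le.2 ?_
      rintro _ ⟨u, hu, v, hv, rfl⟩
      simp [hu.2, hv.2]
    have hlt : LinearMap.ker (l : (Fin 3 → ℝ) →ₗ[ℝ] ℝ) < ⊤ := by
      rw [lt_top_iff_ne_top]
      intro h
      have h0 : ∀ v, l v = 0 := fun v => by
        have : v ∈ LinearMap.ker (l : (Fin 3 → ℝ) →ₗ[ℝ] ℝ) := h ▸ Submodule.mem_top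
        exact this
      exact hw (by rw [← hxμ, h0, h0])
    have h1 := Submodule.finrank_lt hlt.ne
    have h2 := Submodule.finrank_mono hle
    rw [Module.finrank_fin_fun] at h1
    omega
  · have hspan : Submodule.span ℝ (Set.range ![y - x, z - x]) ≤
        (affineSpan ℝ {x ∈ P | l x = μ}).direction := by
      have hmem : ∀ u ∈ P, l u = μ → u ∈ affineSpan ℝ {x ∈ P | l x = μ} :=
        fun u hu huμ => subset_affineSpan ℝ _ ⟨hu, huμ⟩
      refine Submodule.span_le.2 ?_
      rintro _ ⟨i, rfl⟩
      fin_cases i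
      · exact AffineSubspace.vsub_mem_direction (hmem y hy hyμ) (hmem x hx hxμ)
      · exact AffineSubspace.vsub_mem_direction (hmem z hz hzμ) (hmem x hx hxμ)
    have h := Submodule.finrank_mono hspan
    rw [finrank_span_eq_card hli, Fintype.card_fin] at h
    exact h

lemma IsFacet.eq_of_subset {P F G : Set (Fin 3 → ℝ)} (hF : IsFacet P F) (hG : IsFacet P G)
    (hFG : F ⊆ G) : F = G := by
  have hne : F.Nonempty := by
    by_contra! h
    have h2 := hF.2
    rw [h, direction_affineSpan, vectorSpan_empty, finrank_bot] at h2
    omega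
  obtain ⟨l, hl⟩ := hF.1 hne
  obtain ⟨x, hx⟩ := hne
  have hconst : ∀ y ∈ F, l y = l x := fun y hy => by
    rw [hl] at hx hy
    exact le_antisymm (hx.2 y hy.1) (hy.2 x hx.1)
  have hdir := Submodule.eq_of_le_of_finrank_eq
    (AffineSubspace.direction_le (affineSpan_mono ℝ hFG)) (hF.2.trans hG.2.symm)
  have hker : (affineSpan ℝ F).direction ≤ LinearMap.ker (l : (Fin 3 → ℝ) →ₗ[ℝ] ℝ) := by
    rw [direction_affineSpan]
    refine Submodule.span_le.2 ?_
    rintro _ ⟨u, hu, v, hv, rfl⟩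
    simp [hconst u hu, hconst v hv]
  refine hFG.antisymm fun y hy => ?_
  have hmem := AffineSubspace.vsub_mem_direction (subset_affineSpan ℝ G hy)
    (subset_affineSpan ℝ G (hFG hx))
  rw [← hdir] at hmem
  have h0 : l (y - x) = 0 := hker hmem
  rw [map_sub, sub_eq_zero] at h0
  rw [hl] at hx ⊢
  exact ⟨hG.1.subset hy, fun z hz => h0 ▸ hx.2 z hz⟩

/-- The number of facets of a polytope with vertices `V j`, from a list of supporting functionals
`n i ≤ M i` with incidence sets `S i`, such that every functional is maximised on
one of the listed faces. -/
lemma ncard_facets_of_incidence {r m : ℕ} {P : Set (Fin 3 → ℝ)} (hfull : IsFullDim P)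
    {V : Fin r → Fin 3 → ℝ} (hP : P = convexHull ℝ (Set.range V))
    {n : Fin m → (Fin 3 → ℝ) →L[ℝ] ℝ} {M : Fin m → ℝ} {S : Fin m → Finset (Fin r)}
    (hS : Function.Injective S) (heq : ∀ i, ∀ j ∈ S i, n i (V j) = M i)
    (hlt : ∀ i, ∀ j ∉ S i, n i (V j) < M i) (hproper : ∀ i, ∃ j, j ∉ S i)
    (hdim : ∀ i, ∃ j₁ ∈ S i, ∃ j₂ ∈ S i, ∃ j₃ ∈ S i,
      LinearIndependent ℝ ![V j₂ - V j₁, V j₃ - V j₁])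
    (henum : ∀ (l : (Fin 3 → ℝ) →L[ℝ] ℝ) (μ : ℝ), (∀ j, l (V j) ≤ μ) →
      (∀ j, l (V j) = μ) ∨ ∃ i, ∀ j, l (V j) = μ → j ∈ S i) :
    {F | IsFacet P F}.ncard = m := by
  have hVP : ∀ j, V j ∈ P := fun j => hP ▸ subset_convexHull ℝ _ ⟨j, rfl⟩
  have hle : ∀ i, ∀ x ∈ P, n i x ≤ M i := by
    intro i x hx
    rw [hP] at hx
    refine (convexHull_min (t := {x | n i x ≤ M i}) ?_
      (convex_halfSpace_le (n i).isLinear _)) hx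
    rintro _ ⟨j, rfl⟩
    by_cases hj : j ∈ S i
    exacts [(heq i j hj).le, (hlt i j hj).le]
  set G : Fin m → Set (Fin 3 → ℝ) := fun i => {x ∈ P | n i x = M i} with hG
  have hVG : ∀ i j, V j ∈ G i ↔ j ∈ S i := fun i j =>
    ⟨fun h => by_contra fun hj => (hlt i j hj).ne h.2, fun h => ⟨hVP j, heq i j h⟩⟩
  have hGinj : Function.Injective G := fun i i' h => hS (by
    ext j
    rw [← hVG, ← hVG, h])
  have hfacet : ∀ i, IsFacet P (G i) := by
    intro i
    obtain ⟨j, hj⟩ := hproper i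
    obtain ⟨j₁, h₁, j₂, h₂, j₃, h₃, hli⟩ := hdim i
    exact isFacet_of_supporting (hle i) (hlt i j hj).ne (hVP j₁) (heq i j₁ h₁) (hVP j₂)
      (heq i j₂ h₂) (hVP j₃) (heq i j₃ h₃) hli
  have hset : {F | IsFacet P F} = Set.range G := by
    apply Set.Subset.antisymm
    · intro F hF
      have hne : F.Nonempty := by
        by_contra! h
        have h2 := hF.2
        rw [h, direction_affineSpan, vectorSpan_empty, finrank_bot] at h2
        omega
      obtain ⟨l, hl⟩ := hF.1 hne
      obtain ⟨x, hx⟩ := hne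
      have hx' := hx
      rw [hl] at hx'
      have hface : ∀ K : Set (Fin 3 → ℝ), Convex ℝ K → (∀ j, l (V j) = l x → V j ∈ K) →
          ∀ y ∈ F, y ∈ K := by
        intro K hK hVK y hy
        rw [hl] at hy
        have hsub := convexHull_min (s := Set.range V) (by
          rintro _ ⟨j, rfl⟩
          exact ⟨hx'.2 _ (hVP j), hVK j⟩) (convex_halfspace_and_face l (l x) hK)
        rw [← hP] at hsub
        exact (hsub hy.1).2 (le_antisymm (hx'.2 y hy.1) (hy.2 x hx'.1))
      rcases henum l (l x) (fun j => hx'.2 _ (hVP j)) with hall | ⟨i, hi⟩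
      · have hPF : F = P := by
          refine hF.1.subset.antisymm fun y hy => ?_
          have hsub := convexHull_min (s := Set.range V) (t := {y | l y = l x}) (by
            rintro _ ⟨j, rfl⟩
            exact hall j) (convex_hyperplane l.isLinear _)
          rw [← hP] at hsub
          rw [hl]
          exact ⟨hy, fun z hz => (hx'.2 z hz).trans (hsub hy).ge⟩
        have h2 := hF.2
        rw [hPF, hfull, AffineSubspace.direction_top, finrank_top, Module.finrank_fin_fun] at h2
        omega
      · refine ⟨i, (hF.eq_of_subset (hfacet i) fun y hy => ⟨hF.1.subset hy, ?_⟩).symm⟩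
        exact hface {y | n i y = M i} (convex_hyperplane (n i).isLinear _)
          (fun j hj => heq i j (hi j hj)) y hy
    · rintro _ ⟨i, rfl⟩
      exact hfacet i
  rw [hset, ← Set.image_univ, Set.ncard_image_of_injective _ hGinj, Set.ncard_univ,
    Nat.card_eq_fintype_card, Fintype.card_fin]

lemma cayley_convexHull {k : ℝ} {S T : Set (Fin 2 → ℝ)} :
    cayley k (convexHull ℝ S) (convexHull ℝ T) = cayley k S T := by
  apply Set.Subset.antisymm
  · refine cayley_subset (convex_convexHull ℝ _) (fun u hu => ?_) fun u hu => ?_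
    · exact convexHull_min (fun u hu => emb_zero_mem_cayley hu)
        (convex_preimage_emb (convex_convexHull ℝ _) 0) hu
    · exact convexHull_min (fun u hu => emb_mem_cayley hu)
        (convex_preimage_emb (convex_convexHull ℝ _) k) hu
  · exact cayley_subset (convex_convexHull ℝ _)
      (fun u hu => emb_zero_mem_cayley (subset_convexHull ℝ _ hu))
      fun u hu => emb_mem_cayley (subset_convexHull ℝ _ hu)

/-- A trapezoid with sides `pp'` and `qq'` in the direction of the kernel of `f`. -/
structure IsTrapezoid (f g : (Fin 2 → ℝ) →L[ℝ] ℝ) (p p' q q' : Fin 2 → ℝ) : Prop where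
  f_bot : f p' = f p
  f_top : f q' = f q
  f_lt : f p < f q
  g_bot : g p < g p'
  g_top : g q < g q'

lemma IsTrapezoid.extremePoints {f g : (Fin 2 → ℝ) →L[ℝ] ℝ} {p p' q q' : Fin 2 → ℝ}
    (h : IsTrapezoid f g p p' q q') :
    Set.extremePoints ℝ (convexHull ℝ {p, p', q, q'}) = {p, p', q, q'} := by
  obtain ⟨h1, h2, h3, h4, h5⟩ := h
  refine extremePoints_convexHull_subset.antisymm ?_
  rintro v (rfl | rfl | rfl | rfl)
  · refine mem_extremePoints_convexHull_of_lex (by simp) (-f) (-g) ?_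
    simp [h1, h2, h3.le, h3.ne', h4.le, h4.ne']
  · refine mem_extremePoints_convexHull_of_lex (by simp) (-f) g ?_
    simp [h1, h2, h3.le, h3.ne', h4.le, h4.ne]
  · refine mem_extremePoints_convexHull_of_lex (by simp) f (-g) ?_
    simp [h1, h2, h3.le, h3.ne, h5.le, h5.ne']
  · refine mem_extremePoints_convexHull_of_lex (by simp) f g ?_
    simp [h1, h2, h3.le, h3.ne, h5.le, h5.ne]

lemma IsTrapezoid.ncard {f g : (Fin 2 → ℝ) →L[ℝ] ℝ} {p p' q q' : Fin 2 → ℝ}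
    (h : IsTrapezoid f g p p' q q') : ({p, p', q, q'} : Set (Fin 2 → ℝ)).ncard = 4 := by
  obtain ⟨h1, h2, h3, h4, h5⟩ := h
  have hpp' : p ≠ p' := fun h => h4.ne (congrArg g h)
  have hqq' : q ≠ q' := fun h => h5.ne (congrArg g h)
  have hpq : p ≠ q := fun h => h3.ne (congrArg f h)
  have hpq' : p ≠ q' := fun h => h3.ne ((congrArg f h).trans h2)
  have hp'q : p' ≠ q := fun h => h3.ne (h1.symm.trans (congrArg f h))
  have hp'q' : p' ≠ q' := fun h => h3.ne (h1.symm.trans ((congrArg f h).trans h2))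
  rw [Set.ncard_insert_of_notMem (by simp [*]), Set.ncard_insert_of_notMem (by simp [*]),
    Set.ncard_pair hqq']

lemma extremePoints_segment_of_lt {n : ℕ} {g : (Fin n → ℝ) →L[ℝ] ℝ} {a b : Fin n → ℝ}
    (h : g a < g b) : Set.extremePoints ℝ (segment ℝ a b) = {a, b} := by
  rw [← convexHull_pair]
  refine extremePoints_convexHull_subset.antisymm ?_
  rintro v (rfl | rfl)
  · refine mem_extremePoints_convexHull_of_lex (by simp) (-g) (-g) ?_
    simp [h.le, h.ne']
  · refine mem_extremePoints_convexHull_of_lex (by simp) g g ?_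
    simp [h.le, h.ne]

lemma exists_smul_eq_of_functionals {n : ℕ} {f g : (Fin n → ℝ) →L[ℝ] ℝ}
    (hfg : ∀ x, f x = 0 → g x = 0 → x = 0) {d e : Fin n → ℝ} (hd : f d = 0) (he : f e = 0)
    (hgd : 0 < g d) (hge : 0 < g e) : ∃ r : ℝ, 0 < r ∧ e = r • d := by
  refine ⟨g e / g d, div_pos hge hgd, sub_eq_zero.1 (hfg _ ?_ ?_)⟩
  · simp [hd, he]
  · simp [div_mul_cancel₀ _ hgd.ne']

lemma exists_affine_coeffs {k : ℝ} (hk : k ≠ 0) {f : (Fin 2 → ℝ) →L[ℝ] ℝ}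
    (g : (Fin 2 → ℝ) →L[ℝ] ℝ) (p q a : Fin 2 → ℝ) (hpq : f p < f q) : ∃ u w c : ℝ,
      g p + u * f p = c ∧ g q + u * f q = c ∧ g a + u * f a + w * k = c := by
  have hne : f q - f p ≠ 0 := (sub_pos.2 hpq).ne'
  refine ⟨(g p - g q) / (f q - f p), (g p + (g p - g q) / (f q - f p) * f p - g a -
    (g p - g q) / (f q - f p) * f a) / k, _, rfl, ?_, ?_⟩
  · field_simp
    ring
  · rw [div_mul_cancel₀ _ hk]
    ring

/-- The Cayley polytope of a trapezoid and a segment parallel to two of its sides has five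
facets. -/
lemma IsTrapezoid.ncard_facets_cayley {k : ℝ} (hk : 0 < k) {f g : (Fin 2 → ℝ) →L[ℝ] ℝ}
    (hfg : ∀ x, f x = 0 → g x = 0 → x = 0) {p p' q q' a b : Fin 2 → ℝ}
    (h : IsTrapezoid f g p p' q q') (hab : f b = f a) (hgab : g a < g b)
    (hfull : IsFullDim (cayley k {p, p', q, q'} {a, b})) :
    {F | IsFacet (cayley k {p, p', q, q'} {a, b}) F}.ncard = 5 := by
  obtain ⟨h1, h2, h3, h4, h5⟩ := h
  obtain ⟨u, w, c, hp, hq, ha⟩ := exists_affine_coeffs hk.ne' g p q a h3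
  obtain ⟨u', w', c', hp', hq', hb⟩ := exists_affine_coeffs hk.ne' g p' q' b (by rwa [h1, h2])
  have ha₁ : -f a + (f a - f p) / k * k = -f p := by
    rw [div_mul_cancel₀ _ hk.ne']
    ring
  have ha₂ : f a + (f q - f a) / k * k = f q := by
    rw [div_mul_cancel₀ _ hk.ne']
    ring
  refine ncard_facets_of_incidence hfull
    (V := ![emb 0 p, emb 0 p', emb 0 q, emb 0 q', emb k a, emb k b])
    (n := ![cayleyFunctional 0 (-1), cayleyFunctional (-f) ((f a - f p) / k),
      cayleyFunctional f ((f q - f a) / k), cayleyFunctional (-(g + u • f)) (-w),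
      cayleyFunctional (g + u' • f) w'])
    (M := ![0, -f p, f q, -c, c'])
    (S := ![{0, 1, 2, 3}, {0, 1, 4, 5}, {2, 3, 4, 5}, {0, 2, 4}, {1, 3, 5}]) ?_ ?_ ?_ ?_ ?_ ?_ ?_
  · have hV : emb 0 '' {p, p', q, q'} ∪ emb k '' {a, b} = Set.range
        ![emb 0 p, emb 0 p', emb 0 q, emb 0 q', emb k a, emb k b] := by
      ext x
      simp [Set.image_insert_eq]
      tauto
    exact congrArg (convexHull ℝ) hV
  · decide
  · simp [Fin.forall_fin_succ, h1, h2, hab, ha₁, ha₂]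
    rw [h1] at hp'
    rw [h2] at hq'
    rw [hab] at hb
    exact ⟨⟨by linarith, by linarith, by linarith⟩, hp', hq', hb⟩
  · simp [Fin.forall_fin_succ, h1, h2, hab, hp, hq, ha₁, ha₂, hk, h3]
    rw [h1] at hp'
    rw [h2] at hq'
    rw [hab] at hb
    refine ⟨⟨?_, ?_, ?_⟩, ?_, ?_, ?_⟩ <;> linarith
  · decide
  · have hk' := hk.ne'
    have hgp : g p' - g p ≠ 0 := (sub_pos.2 h4).ne'
    have hgq : g q' - g q ≠ 0 := (sub_pos.2 h5).ne'
    have hgab' : g b - g a ≠ 0 := (sub_pos.2 hgab).ne'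
    have hfpq : f q - f p ≠ 0 := (sub_pos.2 h3).ne'
    have hp4 : ∀ {x y z : Fin 3 → ℝ} (φ ψ : (Fin 3 → ℝ) →L[ℝ] ℝ), φ y - φ x ≠ 0 →
        ψ y = ψ x → ψ z - ψ x ≠ 0 → LinearIndependent ℝ ![y - x, z - x] :=
      fun φ ψ hφ hψ hz => linearIndependent_pair_of_triangular φ ψ (by simpa using hφ)
        (by simp [hψ]) (by simpa using hz)
    intro i
    fin_cases i
    · exact ⟨0, by decide, 1, by decide, 2, by decide,
        hp4 (cayleyFunctional g 0) (cayleyFunctional f 0) (by simpa) (by simpa) (by simpa)⟩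
    · exact ⟨4, by decide, 5, by decide, 0, by decide,
        hp4 (cayleyFunctional g 0) (cayleyFunctional 0 1) (by simpa) (by simp) (by simpa)⟩
    · exact ⟨4, by decide, 5, by decide, 2, by decide,
        hp4 (cayleyFunctional g 0) (cayleyFunctional 0 1) (by simpa) (by simp) (by simpa)⟩
    · exact ⟨0, by decide, 2, by decide, 4, by decide,
        hp4 (cayleyFunctional f 0) (cayleyFunctional 0 1) (by simpa) (by simp) (by simpa)⟩
    · exact ⟨1, by decide, 3, by decide, 5, by decide,
        hp4 (cayleyFunctional f 0) (cayleyFunctional 0 1) (by simpa [h1, h2]) (by simp) (by simpa)⟩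
  · intro l μ hl
    have hpar : ∀ (t : ℝ) (x y : Fin 2 → ℝ), f y = f x → g x < g y → ∃ r > 0,
        l (emb t y) - l (emb t x) = r * (l (emb k b) - l (emb k a)) := by
      intro t x y hf hg
      obtain ⟨r, hr, hxy⟩ := exists_smul_eq_of_functionals hfg (d := b - a) (e := y - x)
        (by simp [hab]) (by simp [hf]) (by simpa) (by simpa)
      refine ⟨r, hr, ?_⟩
      have : emb t y - emb t x = r • (emb k b - emb k a) :=
        eq_of_dropLast_eq (by simpa using hxy) (by simp)
      simpa using congrArg l this
    obtain ⟨r, hr, hpp⟩ := hpar 0 p p' h1 h4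
    obtain ⟨r', hr', hqq⟩ := hpar 0 q q' h2 h5
    simp only [Fin.forall_fin_succ] at hl ⊢
    simp at hl ⊢
    obtain ⟨l1, l2, l3, l4, l5, l6⟩ := hl
    rcases lt_trichotomy (l (emb k b) - l (emb k a)) 0 with hD | hD | hD
    · have e1 := mul_neg_of_pos_of_neg hr hD
      have e2 := mul_neg_of_pos_of_neg hr' hD
      refine Or.inr ⟨3, ?_⟩
      simp
      refine ⟨?_, ?_, ?_⟩ <;> exact fun h => by linarith
    · rw [hD, mul_zero] at hpp hqq
      by_cases hA : l (emb k a) = μ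
      · by_cases hq₀ : l (emb 0 q) = μ
        · by_cases hp₀ : l (emb 0 p) = μ
          · left
            refine ⟨?_, ?_, ?_, ?_, ?_, ?_⟩ <;> linarith
          · refine Or.inr ⟨2, ?_⟩
            simp
            exact ⟨hp₀, fun h => hp₀ (by linarith)⟩
        · refine Or.inr ⟨1, ?_⟩
          simp
          exact ⟨hq₀, fun h => hq₀ (by linarith)⟩
      · refine Or.inr ⟨0, ?_⟩
        simp
        exact ⟨hA, fun h => hA (by linarith)⟩
    · have e1 := mul_pos hr hD
      have e2 := mul_pos hr' hD
      refine Or.inr ⟨4, ?_⟩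
      simp
      refine ⟨?_, ?_, ?_⟩ <;> exact fun h => by linarith

lemma IsTrapezoid.mem_convexHull {f g : (Fin 2 → ℝ) →L[ℝ] ℝ} {p p' q q' x : Fin 2 → ℝ}
    (h : IsTrapezoid f g p p' q q') (hfg : ∀ x, f x = 0 → g x = 0 → x = 0)
    {u u' c c' : ℝ} (hp : g p + u * f p = c) (hq : g q + u * f q = c)
    (hp' : -g p' + u' * f p' = c') (hq' : -g q' + u' * f q' = c')
    (hpx : f p ≤ f x) (hxq : f x ≤ f q) (hx : c ≤ g x + u * f x) (hx' : c' ≤ -g x + u' * f x) :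
    x ∈ convexHull ℝ {p, p', q, q'} := by
  have hpos : 0 < f q - f p := sub_pos.2 h.f_lt
  obtain ⟨s, t, hs, ht, hst, hfx⟩ : f x ∈ segment ℝ (f p) (f q) := by
    rw [segment_eq_Icc h.f_lt.le]
    exact ⟨hpx, hxq⟩
  simp only [smul_eq_mul] at hfx
  have hmem : ∀ y ∈ ({p, p', q, q'} : Set _), ∀ z ∈ ({p, p', q, q'} : Set _),
      s • y + t • z ∈ convexHull ℝ {p, p', q, q'} := fun y hy z hz =>
    convex_convexHull ℝ _ (subset_convexHull ℝ _ hy) (subset_convexHull ℝ _ hz) hs ht hst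
  refine (convex_convexHull ℝ _).segment_subset (hmem p (by simp) q (by simp))
    (hmem p' (by simp) q' (by simp))
    (mem_segment_of_functionals hfg (by simpa using hfx) (by simpa [h.f_bot, h.f_top] using hfx)
      ?_ ?_)
  · have e : g (s • p + t • q) + u * f x = c := by
      rw [← hfx]
      simp only [map_add, map_smul, smul_eq_mul]
      linear_combination s * hp + t * hq + c * hst
    linarith
  · have e : -g (s • p' + t • q') + u' * f x = c' := by
      rw [← hfx]
      rw [h.f_bot] at hp'
      rw [h.f_top] at hq'
      simp only [map_add, map_smul, smul_eq_mul]
      linear_combination s * hp' + t * hq' + c' * hst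
    linarith

/-- The base of a simple Cayley polytope over a polygon and a segment is a trapezoid with two sides
parallel to the segment. -/
lemma exists_trapezoid_of_simple {k : ℝ} (hk : 0 < k) {P₀ : Set (Fin 2 → ℝ)} {a b : Fin 2 → ℝ}
    (hconv : Convex ℝ P₀) (hcpt : IsCompact P₀) (hfull : IsFullDim P₀) (hab : a ≠ b)
    (hcone : ∀ v ∈ Set.extremePoints ℝ (cayley k P₀ (segment ℝ a b)),
      HasSimplicialCone (cayley k P₀ (segment ℝ a b)) v) :
    ∃ f g : (Fin 2 → ℝ) →L[ℝ] ℝ, ∃ p p' q q', (∀ x, f x = 0 → g x = 0 → x = 0) ∧ f b = f a ∧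
      g a < g b ∧ IsTrapezoid f g p p' q q' ∧ P₀ = convexHull ℝ {p, p', q, q'} := by
  obtain ⟨f, g, hfd, hgd, hf0, hfg⟩ := exists_perp_and_dot (sub_ne_zero.2 hab.symm)
  rw [map_sub, sub_eq_zero] at hfd
  rw [map_sub, sub_pos] at hgd
  have hconst : ∀ x ∈ segment ℝ a b, f x = f a ∧ g a ≤ g x ∧ g x ≤ g b := by
    rintro _ ⟨s, t, hs, ht, hst, rfl⟩
    obtain rfl : s = 1 - t := by linarith
    simp only [map_add, map_smul, smul_eq_mul, hfd]
    refine ⟨by ring, ?_, ?_⟩ <;> nlinarith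
  have ha := left_mem_segment ℝ a b
  have hb := right_mem_segment ℝ a b
  obtain ⟨q, hq, q', hq', hfq, hqq', hgq, hgqx⟩ := exists_parallel_edge hk hconv
    (convex_segment a b) hcpt hfull hcone ha hb hab (fun x hx => (hconst x hx).1) hfg
  obtain ⟨p, hp, p', hp', hfp, hpp', hgp, hgpx⟩ := exists_parallel_edge hk hconv
    (convex_segment a b) hcpt hfull hcone ha hb hab (f := -f) (g := g)
    (fun x hx => by simp [(hconst x hx).1]) (fun x hx => hfg x (by simpa using hx))
  simp only [neg_apply, neg_inj, neg_le_neg_iff] at hfp hpp' hgpx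
  have hpq : f p < f q := by
    refine lt_of_le_of_ne (hfp q hq) fun h => ?_
    obtain ⟨x, hx, hne⟩ := hfull.exists_ne hf0 p
    exact hne (le_antisymm (h ▸ hfq x hx) (hfp x hx))
  have htrap : IsTrapezoid f g p p' q q' := ⟨hpp', hqq', hpq, hgp, hgq⟩
  refine ⟨f, g, p, p', q, q', hfg, hfd, hgd, htrap, ?_⟩
  have hext : Set.extremePoints ℝ (cayley k P₀ (segment ℝ a b)) =
      emb 0 '' Set.extremePoints ℝ P₀ ∪ emb k '' {a, b} := by
    rw [extremePoints_cayley hk hconv (convex_segment a b), extremePoints_segment_of_lt hgd]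
  obtain ⟨u, w, c, hpc, hqc, hac⟩ := exists_affine_coeffs hk.ne' g p q a hpq
  have hlow := le_cayleyFunctional_of_simple hk (hcone (emb k a) (by rw [hext]; simp)) hb hp hq
    hfg (fun x hx => (hconst x hx).1) (fun x hx => (hconst x hx).2.1) hgd hpq
    (fun x hx => ⟨hfp x hx, hfq x hx⟩) (fun x hx h => (hgpx x hx h).1)
    (fun x hx h => (hgqx x hx h).1) hpc hqc hac
  obtain ⟨u', w', c', hpc', hqc', hbc⟩ := exists_affine_coeffs hk.ne' (-g) p' q' b
    (by rwa [hpp', hqq'])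
  have hupp := le_cayleyFunctional_of_simple hk (hcone (emb k b) (by rw [hext]; simp)) ha hp' hq'
    (f := f) (g := -g) (fun x hx h => hfg x hx (by simpa using h))
    (fun x hx => by rw [(hconst x hx).1, hfd]) (fun x hx => by simpa using (hconst x hx).2.2)
    (by simpa using hgd) (by rwa [hpp', hqq'])
    (fun x hx => by rw [hpp', hqq']; exact ⟨hfp x hx, hfq x hx⟩)
    (fun x hx h => by simpa using (hgpx x hx (h.trans hpp')).2)
    (fun x hx h => by simpa using (hgqx x hx (h.trans hqq')).2) hpc' hqc' hbc
  apply Set.Subset.antisymm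
  · intro x hx
    refine htrap.mem_convexHull hfg hpc hqc hpc' hqc' (hfp x hx) (hfq x hx) ?_ ?_
    · simpa using hlow _ (emb_zero_mem_cayley hx)
    · simpa using hupp _ (emb_zero_mem_cayley hx)
  · refine convexHull_min ?_ hconv
    rintro x (rfl | rfl | rfl | rfl) <;> assumption

/-- (Case of Proposition 3.8.) If `P₀ ⊂ ℝ²` is a 2-dimensional lattice
polygon, `P₁ ⊂ ℝ²` is a 1-dimensional lattice segment, and
`P = conv((P₀ × {0}) ∪ (P₁ × {k}))` is a full-dimensional smooth lattice polytope,
then `P₀` has exactly 4 vertices, `P` has exactly 6 vertices, and `P` has exactly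
5 facets. -/
theorem stmt_12 (k : ℕ) (hk : 1 ≤ k) (P₀ P₁ : Set (Fin 2 → ℝ))
    (h0 : IsLatticePolytope P₀) (h0d : IsFullDim P₀)
    (h1 : IsLatticePolytope P₁)
    (h1d : Module.finrank ℝ (affineSpan ℝ P₁).direction = 1)
    (hP : IsSmoothPolytope (convexHull ℝ (emb 0 '' P₀ ∪ emb (k : ℝ) '' P₁))) :
    (Set.extremePoints ℝ P₀).ncard = 4 ∧
    (Set.extremePoints ℝ (convexHull ℝ (emb 0 '' P₀ ∪ emb (k : ℝ) '' P₁))).ncard = 6 ∧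
    {F | IsFacet (convexHull ℝ (emb 0 '' P₀ ∪ emb (k : ℝ) '' P₁)) F}.ncard = 5 := by
  have hk' : (0 : ℝ) < k := by exact_mod_cast hk
  obtain ⟨a, b, hab, rfl⟩ := exists_eq_segment h1.isCompact h1.convex h1d
  obtain ⟨f, g, p, p', q, q', hfg, hfab, hgab, htrap, rfl⟩ := exists_trapezoid_of_simple hk'
    h0.convex h0.isCompact h0d hab fun v hv => hP.hasSimplicialCone hv
  refine ⟨by rw [htrap.extremePoints, htrap.ncard], ?_, ?_⟩
  · rw [extremePoints_cayley hk' (convex_convexHull ℝ _) (convex_segment a b),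
      htrap.extremePoints, extremePoints_segment_of_lt hgab, Set.ncard_union_eq,
      Set.ncard_image_of_injective _ (emb_injective _),
      Set.ncard_image_of_injective _ (emb_injective _), htrap.ncard, Set.ncard_pair hab]
    rw [Set.disjoint_left]
    rintro _ ⟨x, -, rfl⟩ ⟨y, -, hxy⟩
    exact hk'.ne' (by simpa using congrFun hxy 2)
  · have hfull := hP.2.1
    have hcayley := cayley_convexHull (k := k) (S := {p, p', q, q'}) (T := {a, b})
    rw [convexHull_pair] at hcayley
    rw [show convexHull ℝ _ = _ from hcayley] at hfull ⊢
    exact htrap.ncard_facets_cayley hk' hfg hfab hgab hfull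
end
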